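/- For every nonnegative integer n and every k with 0 ≤ k ≤ 4, the number of partitions of 5n+4 whose rank is congruent to k modulo 5 equals p(5n+4)/5; that is, N(k,5,5n+4) = p(5n+4)/5. -/

import Mathlib

/-- The *rank* of a partition: its largest part minus its number of parts. -/
def partitionRank {n : ℕ} (p : Nat.Partition n) : ℤ :=
  (p.parts.sup : ℤ) - (Multiset.card p.parts : ℤ)

open Filter Topology

/-- Triangular numbers, extended to the integers. -/
def tri (n : ℤ) : ℤ := n * (n + 1) / 2

lemma two_mul_tri (n : ℤ) : 2 * tri n = n * (n + 1) :=
  Int.mul_ediv_cancel' (Int.even_mul_succ_self n).two_dvd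

lemma tri_add (m n : ℤ) : tri (m + n) = tri m + tri n + m * n := by
  have h1 := two_mul_tri (m + n)
  have h2 := two_mul_tri m
  have h3 := two_mul_tri n
  apply mul_left_cancel₀ (two_ne_zero : (2 : ℤ) ≠ 0)
  linear_combination h1 - h2 - h3

lemma tri_zero : tri 0 = 0 := rfl

lemma tri_succ (n : ℤ) : tri (n + 1) = tri n + n + 1 := by
  rw [tri_add]; simp [tri]; ring

lemma tri_neg (n : ℤ) : tri (-n) = tri n - n := by
  have h2 := two_mul_tri (-n)
  have h3 := two_mul_tri n
  apply mul_left_cancel₀ (two_ne_zero : (2 : ℤ) ≠ 0)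
  linear_combination h2 - h3

lemma summable_rho {ρ B : ℝ} (h0 : 0 < ρ) (h1 : ρ < 1) (hB : 0 < B) :
    Summable fun n : ℤ => ρ ^ tri n * B ^ n := by
  apply Summable.of_nat_of_neg
  · apply summable_of_ratio_test_tendsto_lt_one (l := 0) (by norm_num)
    · exact Eventually.of_forall fun n => by positivity
    · have : Tendsto (fun n : ℕ => ρ ^ n * (ρ * B)) atTop (𝓝 (0 * (ρ * B))) :=
        (tendsto_pow_atTop_nhds_zero_of_lt_one h0.le h1).mul_const _
      rw [zero_mul] at this
      refine this.congr fun n => ?_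
      have e : ρ ^ tri ((n + 1 : ℕ) : ℤ) * B ^ ((n + 1 : ℕ) : ℤ)
          = (ρ ^ n * (ρ * B)) * (ρ ^ tri n * B ^ (n : ℤ)) := by
        push_cast
        rw [tri_succ, zpow_add₀ h0.ne', zpow_add₀ h0.ne', zpow_add₀ hB.ne']
        simp; ring
      rw [e, norm_mul, mul_div_assoc, div_self (norm_ne_zero_iff.2 (mul_pos (zpow_pos h0 _) (zpow_pos hB _)).ne'), mul_one, Real.norm_of_nonneg]
      positivity
  · apply summable_of_ratio_test_tendsto_lt_one (l := 0) (by norm_num)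
    · exact Eventually.of_forall fun n => by positivity
    · have : Tendsto (fun n : ℕ => ρ ^ n * B⁻¹) atTop (𝓝 (0 * B⁻¹)) :=
        (tendsto_pow_atTop_nhds_zero_of_lt_one h0.le h1).mul_const _
      rw [zero_mul] at this
      refine this.congr fun n => ?_
      have e : ρ ^ tri (-((n + 1 : ℕ) : ℤ)) * B ^ (-((n + 1 : ℕ) : ℤ))
          = (ρ ^ n * B⁻¹) * (ρ ^ tri (-n) * B ^ (-n : ℤ)) := by
        push_cast
        rw [tri_neg, tri_succ, show tri n + n + 1 - ((n : ℤ) + 1) = tri (-n) + n by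
          rw [tri_neg]; ring, zpow_add₀ h0.ne', neg_add, zpow_add₀ hB.ne']
        simp; ring
      rw [e, norm_mul, mul_div_assoc, div_self (norm_ne_zero_iff.2 (mul_pos (zpow_pos h0 _) (zpow_pos hB _)).ne'), mul_one, Real.norm_of_nonneg]
      positivity

lemma exists_inv_bound {p : ℂ} (hp0 : p ≠ 0) (hp : ‖p‖ < 1) (z : ℂ) :
    ∃ C : ℝ, 1 ≤ C ∧ ∀ m : ℤ, ‖(1 - z * p ^ m)⁻¹‖ ≤ C := by
  rcases eq_or_ne z 0 with rfl | hz
  · exact ⟨1, le_rfl, fun m => by simp⟩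
  have hpow : Tendsto (fun m : ℕ => p ^ m) atTop (𝓝 0) :=
    tendsto_pow_atTop_nhds_zero_of_norm_lt_one hp
  have h1 : Tendsto (fun m : ℕ => ‖(1 - z * p ^ (m : ℤ))⁻¹‖) atTop (𝓝 ‖(1 - z * 0)⁻¹‖) := by
    simp only [zpow_natCast]
    exact ((tendsto_const_nhds.sub (tendsto_const_nhds.mul hpow)).inv₀ (by simp)).norm
  have h2 : Tendsto (fun m : ℕ => ‖(1 - z * p ^ (-m : ℤ))⁻¹‖) atTop
      (𝓝 ‖0 * (0 - z)⁻¹‖) := by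
    have : Tendsto (fun m : ℕ => ‖p ^ m * (p ^ m - z)⁻¹‖) atTop (𝓝 ‖0 * (0 - z)⁻¹‖) :=
      (hpow.mul ((hpow.sub tendsto_const_nhds).inv₀ (by simpa using hz))).norm
    refine this.congr fun m => ?_
    rw [zpow_neg, zpow_natCast]
    congr 1
    have : p ^ m ≠ 0 := pow_ne_zero _ hp0
    rw [show 1 - z * (p ^ m)⁻¹ = (p ^ m)⁻¹ * (p ^ m - z) by field_simp, mul_inv, inv_inv]
  obtain ⟨C1, hC1⟩ := h1.bddAbove_range
  obtain ⟨C2, hC2⟩ := h2.bddAbove_range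
  refine ⟨max 1 (max C1 C2), le_max_left _ _, fun m => ?_⟩
  obtain ⟨n, rfl | rfl⟩ := m.eq_nat_or_neg
  · exact (hC1 ⟨n, rfl⟩).trans (by simp)
  · exact (hC2 ⟨n, rfl⟩).trans (by simp)

/-- Coefficients of the theta function with nome `p`. -/
noncomputable def theta (p : ℂ) (n : ℤ) : ℂ := (-1) ^ n * p ^ tri (n - 1)

/-- The theta function vanishing at the integer powers of `p`. -/
noncomputable def jt (p x : ℂ) : ℂ := ∑' n : ℤ, theta p n * x ^ n

lemma theta_succ {p : ℂ} (hp0 : p ≠ 0) (n : ℤ) : theta p (n + 1) = -(p ^ n * theta p n) := by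
  unfold theta
  rw [show n + 1 - 1 = (n - 1) + 1 by ring, tri_succ, zpow_add₀ (by norm_num),
    show tri (n - 1) + (n - 1) + 1 = n + tri (n - 1) by ring, zpow_add₀ hp0]
  ring

lemma theta_reflect (p : ℂ) (n : ℤ) : theta p (1 - n) = -theta p n := by
  unfold theta
  rw [show 1 - n - 1 = -n by ring, tri_neg, show tri n - n = tri (n - 1) by
    have := tri_succ (n - 1); rw [sub_add_cancel] at this; omega, sub_eq_add_neg,
    zpow_add₀ (by norm_num), zpow_neg, ← inv_zpow]
  norm_num

lemma summable_rho_shift {ρ B : ℝ} (h0 : 0 < ρ) (h1 : ρ < 1) (hB : 0 < B) :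
    Summable fun n : ℤ => ρ ^ tri (n - 1) * B ^ n := by
  have := (summable_rho h0 h1 hB).comp_injective (sub_left_injective (b := (1 : ℤ)))
  refine (this.mul_left B).congr fun n => ?_
  simp only [Function.comp]
  rw [zpow_sub₀ hB.ne']
  field_simp

lemma summable_theta {p x : ℂ} (hp0 : p ≠ 0) (hp : ‖p‖ < 1) (hx : x ≠ 0) :
    Summable fun n : ℤ => ‖theta p n * x ^ n‖ := by
  refine (summable_rho_shift (norm_pos_iff.2 hp0) hp (norm_pos_iff.2 hx)).congr fun n => ?_
  simp [theta]

lemma jt_mul {p x : ℂ} (hp0 : p ≠ 0) (hx : x ≠ 0) : jt p (p * x) = -(x⁻¹ * jt p x) := by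
  unfold jt
  rw [← tsum_mul_left, ← tsum_neg, ← (Equiv.addRight (1 : ℤ)).tsum_eq fun n => -(x⁻¹ * _)]
  refine tsum_congr fun n => ?_
  simp only [Equiv.coe_addRight]
  rw [theta_succ hp0, mul_zpow, zpow_add₀ hx]
  field_simp

lemma jt_inv {p x : ℂ} (hx : x ≠ 0) : jt p x⁻¹ = -(x⁻¹ * jt p x) := by
  unfold jt
  rw [← tsum_mul_left, ← tsum_neg, ← (Equiv.subLeft (1 : ℤ)).tsum_eq fun n => -(x⁻¹ * _)]
  refine tsum_congr fun n => ?_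
  simp only [Equiv.subLeft_apply]
  rw [theta_reflect, zpow_sub₀ hx, inv_zpow]
  field_simp

lemma jt_one (p : ℂ) : jt p 1 = 0 := by
  have := jt_inv (p := p) (one_ne_zero (α := ℂ))
  simp at this
  exact self_eq_neg.1 this

lemma tsum_theta (p : ℂ) : ∑' n, theta p n = 0 := by
  simpa [jt] using jt_one p

lemma theta_zero (p : ℂ) : theta p 0 = 1 := by simp [theta, tri]

lemma theta_neg (p : ℂ) (m : ℤ) : theta p (-m) = (-1) ^ m * p ^ tri m := by
  unfold theta
  rw [show -m - 1 = -(m + 1) by ring, tri_neg, tri_succ, zpow_neg, ← inv_zpow]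
  norm_num

lemma jt_differentiableAt {p x : ℂ} (hp0 : p ≠ 0) (hp : ‖p‖ < 1) (hx : x ≠ 0) :
    DifferentiableAt ℂ (jt p) x := by
  have hx' : 0 < ‖x‖ := norm_pos_iff.2 hx
  set U : Set ℂ := {y | ‖x‖ / 2 < ‖y‖ ∧ ‖y‖ < 2 * ‖x‖} with hU
  have hUo : IsOpen U :=
    (isOpen_lt continuous_const continuous_norm).inter (isOpen_lt continuous_norm continuous_const)
  have hxU : x ∈ U := ⟨by linarith, by linarith⟩
  have hs : Summable fun n : ℤ => ‖theta p n‖ * (‖x‖ / 2) ^ n + ‖theta p n‖ * (2 * ‖x‖) ^ n := by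
    have h1 := summable_theta hp0 hp (x := ((‖x‖ / 2 : ℝ) : ℂ)) (by exact_mod_cast (by positivity))
    have h2 := summable_theta hp0 hp (x := ((2 * ‖x‖ : ℝ) : ℂ)) (by exact_mod_cast (by positivity))
    refine (h1.add h2).congr fun n => ?_
    simp
  refine (Complex.differentiableOn_tsum_of_summable_norm hs (fun n => ?_) hUo ?_).differentiableAt
    (hUo.mem_nhds hxU)
  · intro y hy
    have : y ≠ 0 := norm_pos_iff.1 (lt_trans (by positivity) hy.1)
    exact ((differentiableAt_zpow.2 (Or.inl this)).const_mul _).differentiableWithinAt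
  · intro n y hy
    rw [norm_mul, norm_zpow, ← mul_add]
    refine mul_le_mul_of_nonneg_left ?_ (norm_nonneg _)
    have hy0 : 0 < ‖y‖ := lt_trans (by positivity) hy.1
    rcases le_total 0 n with h | h
    · exact (zpow_le_zpow_left₀ h hy0.le hy.2.le).trans (le_add_of_nonneg_left (by positivity))
    · refine le_trans ?_ (le_add_of_nonneg_right (by positivity))
      obtain ⟨k, rfl⟩ : ∃ k, n = -k := ⟨-n, by ring⟩
      rw [zpow_neg, zpow_neg]
      exact inv_anti₀ (by positivity) (zpow_le_zpow_left₀ (by omega) (by positivity) hy.1.le)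

/-- The theta function transforms under translations of its argument. -/
lemma jt_zpow_mul {p c : ℂ} (hp0 : p ≠ 0) (hc : c ≠ 0) (m : ℤ) :
    jt p (p ^ m * c) = (-1) ^ m * c ^ (-m) * p ^ (-tri (m - 1)) * jt p c := by
  unfold jt
  rw [← tsum_mul_left, ← (Equiv.addRight m).tsum_eq fun n => (-1) ^ m * _ * _ * (_ * _)]
  refine tsum_congr fun n => ?_
  simp only [Equiv.coe_addRight]
  unfold theta
  rw [mul_zpow, ← zpow_mul, zpow_add₀ (a := c) hc, zpow_neg c,
    show n + m - 1 = (n - 1) + m by ring, tri_add, zpow_add₀ (a := p) hp0, zpow_add₀ (a := p) hp0,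
    zpow_add₀ (by norm_num : (-1 : ℂ) ≠ 0)]
  have e : p ^ (-tri (m - 1)) * (p ^ tri m * p ^ ((n - 1) * m)) = p ^ (m * n) := by
    rw [← zpow_add₀ hp0, ← zpow_add₀ hp0]
    congr 1
    have := tri_succ (m - 1)
    rw [sub_add_cancel] at this
    rw [this]; ring
  have e2 : ((-1 : ℂ) ^ m) * (-1) ^ m = 1 := by
    rw [← mul_zpow]; norm_num
  have hcm : c ^ m ≠ 0 := zpow_ne_zero _ hc
  rw [← e]
  field_simp
  linear_combination -e2

/-- The reciprocal theta function as a partial fraction sum; a vanishing denominator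
contributes zero. -/
noncomputable def pfA (p z : ℂ) : ℂ := ∑' m : ℤ, (-1) ^ m * p ^ tri m * (1 - z * p ^ m)⁻¹

/-- The level three Appell sum; a vanishing denominator contributes zero. -/
noncomputable def appell (p y s : ℂ) : ℂ :=
  ∑' m : ℤ, (-1) ^ m * p ^ (3 * tri m) * s ^ m * (1 - y * p ^ m)⁻¹

lemma Summable.mul_inv_bound {p : ℂ} (hp0 : p ≠ 0) (hp : ‖p‖ < 1) {f : ℤ → ℂ}
    (hf : Summable fun n => ‖f n‖) (z : ℂ) :
    Summable fun n : ℤ => ‖f n * (1 - z * p ^ n)⁻¹‖ := by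
  obtain ⟨C, -, hC⟩ := exists_inv_bound hp0 hp z
  refine Summable.of_nonneg_of_le (fun n => norm_nonneg _) (fun n => ?_) (hf.mul_right C)
  rw [norm_mul]
  exact mul_le_mul_of_nonneg_left (hC n) (norm_nonneg _)

lemma summable_appell_coeff {p s : ℂ} (hp0 : p ≠ 0) (hp : ‖p‖ < 1) (hs : s ≠ 0) :
    Summable fun m : ℤ => ‖(-1) ^ m * p ^ (3 * tri m) * s ^ m‖ := by
  refine (summable_rho (ρ := ‖p‖ ^ 3) (by positivity) (pow_lt_one₀ (norm_nonneg _) hp (by norm_num))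
    (norm_pos_iff.2 hs)).congr fun n => ?_
  simp [zpow_mul]

lemma summable_pfA {p : ℂ} (hp0 : p ≠ 0) (hp : ‖p‖ < 1) (y : ℂ) :
    Summable fun m : ℤ => ‖(-1) ^ m * p ^ tri m * (1 - y * p ^ m)⁻¹‖ := by
  refine Summable.mul_inv_bound hp0 hp ?_ y
  refine (summable_rho (ρ := ‖p‖) (by positivity) hp one_pos).congr fun n => ?_
  simp

/-- The constant product of `jt p` and `pfA p`. -/
noncomputable def thetaConst (p : ℂ) : ℂ :=
  ∑' k : ℤ, ∑' m : ℤ, theta p (k - m) * (if 0 ≤ m then 1 else 0)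

lemma summable_norm_theta {p : ℂ} (hp0 : p ≠ 0) (hp : ‖p‖ < 1) :
    Summable fun n : ℤ => ‖theta p n‖ := by
  simpa using summable_theta hp0 hp one_ne_zero

lemma summable_theta_sub {p : ℂ} (hp0 : p ≠ 0) (hp : ‖p‖ < 1) (k : ℤ) :
    Summable fun m : ℤ => ‖theta p (k - m)‖ :=
  (summable_norm_theta hp0 hp).comp_injective (sub_right_injective (b := k))

lemma tsum_theta_sub {p : ℂ} (k : ℤ) : ∑' m : ℤ, theta p (k - m) = 0 := by
  rw [← tsum_theta p, ← (Equiv.subLeft k).tsum_eq (theta p)]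
  rfl

lemma tsum_theta_sub' {p : ℂ} (m : ℤ) : ∑' k : ℤ, theta p (k - m) = 0 := by
  rw [← tsum_theta p, ← (Equiv.subRight m).tsum_eq (theta p)]
  rfl

lemma theta_convolution {p z : ℂ} (hp0 : p ≠ 0) (hp : ‖p‖ < 1)
    (hz0 : z ≠ 0) (hz : ∀ m : ℤ, z * p ^ m ≠ 1) (k : ℤ) :
    ∑' m : ℤ, theta p (k - m) * (1 - z * p ^ m)⁻¹ = theta p k * z ^ k * pfA p z := by
  have hs : ∀ k, Summable fun m : ℤ => theta p (k - m) * (1 - z * p ^ m)⁻¹ := fun k =>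
    ((summable_theta_sub hp0 hp k).mul_inv_bound hp0 hp z).of_norm
  set c : ℤ → ℂ := fun k => ∑' m : ℤ, theta p (k - m) * (1 - z * p ^ m)⁻¹ with hc
  have h0 : c 0 = pfA p z := by
    refine tsum_congr fun m => ?_
    rw [zero_sub, theta_neg]
  have hrec : ∀ k, c (k + 1) = -(z * p ^ k * c k) := by
    intro k
    rw [eq_neg_iff_add_eq_zero, hc]
    simp only
    rw [← tsum_mul_left, ← (hs (k + 1)).tsum_add ((hs k).mul_left _),
      ← tsum_theta_sub (p := p) (k + 1)]
    refine tsum_congr fun m => ?_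
    have hd : 1 - z * p ^ m ≠ 0 := sub_ne_zero.2 (hz m).symm
    have hI := mul_inv_cancel₀ hd
    rw [show k + 1 - m = (k - m) + 1 by ring, theta_succ hp0,
      show p ^ k = p ^ (k - m) * p ^ m by rw [← zpow_add₀ hp0, sub_add_cancel]]
    linear_combination (-p ^ (k - m) * theta p (k - m)) * hI
  change c k = _
  induction k using Int.induction_on with
  | zero => simp [h0, theta_zero]
  | succ n ih =>
    rw [hrec, ih, theta_succ hp0]
    rw [zpow_add_one₀ hz0]; ring
  | pred n ih =>
    have h1 := hrec (-n - 1)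
    have h2 := theta_succ hp0 (-n - 1)
    rw [sub_add_cancel] at h1 h2
    rw [ih, h2] at h1
    have h3 := zpow_ne_zero (-n - 1 : ℤ) hp0
    rw [show z ^ (-n : ℤ) = z ^ (-n - 1 : ℤ) * z by rw [← zpow_add_one₀ hz0]; simp] at h1
    apply mul_left_cancel₀ (mul_ne_zero hz0 h3)
    linear_combination h1

lemma summable_pf_aux {p z : ℂ} (hp0 : p ≠ 0) (hp : ‖p‖ < 1) (hz0 : z ≠ 0)
    (hz : ∀ m : ℤ, z * p ^ m ≠ 1) :
    Summable fun m : ℤ => ‖(1 - z * p ^ m)⁻¹ - (if 0 ≤ m then 1 else 0)‖ := by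
  obtain ⟨C, hC1, hC⟩ := exists_inv_bound hp0 hp z
  obtain ⟨C', hC1', hC'⟩ := exists_inv_bound hp0 hp z⁻¹
  have hg : Summable fun n : ℕ => ‖p‖ ^ n := summable_geometric_of_lt_one (norm_nonneg _) hp
  have hd : ∀ m : ℤ, 1 - z * p ^ m ≠ 0 := fun m => sub_ne_zero.2 (hz m).symm
  apply Summable.of_nat_of_neg
  · refine Summable.of_nonneg_of_le (fun n => norm_nonneg _) (fun n => ?_) (hg.mul_left (‖z‖ * C))
    rw [if_pos (by positivity)]
    have : (1 - z * p ^ (n : ℤ))⁻¹ - 1 = z * p ^ n * (1 - z * p ^ (n : ℤ))⁻¹ := by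
      have := hd n
      rw [zpow_natCast] at *
      generalize p ^ n = P at *
      field_simp
      ring
    rw [this, norm_mul, norm_mul, norm_pow]
    have := hC n
    calc _ ≤ ‖z‖ * ‖p‖ ^ n * C := by gcongr
      _ = _ := by ring
  · refine Summable.of_nonneg_of_le (fun n => norm_nonneg _) (fun n => ?_)
      (hg.mul_left (C + 1 + ‖z⁻¹‖ * C'))
    rcases Nat.eq_zero_or_pos n with rfl | hn
    · have := hC 0
      have h2 : 0 ≤ ‖z⁻¹‖ * C' := by positivity
      refine (norm_sub_le _ _).trans ?_
      simp at this ⊢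
      simp at h2
      linarith
    · rw [if_neg (by omega), sub_zero]
      have : (1 - z * p ^ (-n : ℤ))⁻¹ = -(z⁻¹ * p ^ n * (1 - z⁻¹ * p ^ (n : ℤ))⁻¹) := by
        have h1 := hd (-n)
        rw [zpow_neg, zpow_natCast] at h1
        rw [zpow_neg, zpow_natCast]
        have h3 : p ^ n ≠ 0 := pow_ne_zero _ hp0
        have h2 : 1 - z⁻¹ * p ^ n ≠ 0 := by
          intro h
          apply h1
          field_simp at h ⊢
          linear_combination -h
        have h4 : z - p ^ n ≠ 0 := by
          intro h; apply h2; field_simp; rw [mul_zero]; exact h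
        have h5 : p ^ n - z ≠ 0 := by
          intro h; apply h4; linear_combination -h
        field_simp
        ring
      rw [this, norm_neg, norm_mul, norm_mul, norm_pow]
      have := hC' n
      calc _ ≤ ‖z⁻¹‖ * ‖p‖ ^ n * C' := by gcongr
        _ = ‖z⁻¹‖ * C' * ‖p‖ ^ n := by ring
        _ ≤ _ := by gcongr; linarith

theorem jt_mul_pfA {p z : ℂ} (hp0 : p ≠ 0) (hp : ‖p‖ < 1) (hz0 : z ≠ 0)
    (hz : ∀ m : ℤ, z * p ^ m ≠ 1) : jt p z * pfA p z = thetaConst p := by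
  set u : ℤ → ℂ := fun m => (1 - z * p ^ m)⁻¹ - (if 0 ≤ m then 1 else 0) with hu
  have hus : Summable fun m => ‖u m‖ := summable_pf_aux hp0 hp hz0 hz
  have hF : Summable fun x : ℤ × ℤ => theta p x.1 * u x.2 :=
    summable_mul_of_summable_norm (summable_norm_theta hp0 hp) hus
  let e : ℤ × ℤ ≃ ℤ × ℤ :=
    ⟨fun x => (x.1 - x.2, x.2), fun x => (x.1 + x.2, x.2), fun x => by simp, fun x => by simp⟩
  have hG : Summable fun x : ℤ × ℤ => theta p (x.1 - x.2) * u x.2 := by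
    exact e.summable_iff.2 hF
  have hzero : ∑' k : ℤ, ∑' m : ℤ, theta p (k - m) * u m = 0 := by
    rw [← Summable.tsum_comm (f := fun k m => theta p (k - m) * u m) hG]
    simp [tsum_mul_right, tsum_theta_sub']
  have hGk : Summable fun k : ℤ => ∑' m : ℤ, theta p (k - m) * u m := hG.prod
  have hsk : ∀ k : ℤ, ∑' m : ℤ, theta p (k - m) * (if 0 ≤ m then 1 else 0)
      = theta p k * z ^ k * pfA p z - ∑' m : ℤ, theta p (k - m) * u m := by
    intro k
    rw [← theta_convolution hp0 hp hz0 hz, ← Summable.tsum_sub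
      ((summable_theta_sub hp0 hp k).mul_inv_bound hp0 hp z).of_norm (hG.prod_factor k)]
    refine tsum_congr fun m => ?_
    simp only [hu]
    ring
  unfold thetaConst
  simp_rw [hsk]
  rw [Summable.tsum_sub ((summable_theta hp0 hp hz0).of_norm.mul_right _) hGk, hzero, sub_zero,
    tsum_mul_right]
  rfl

/-- `z` is nonzero and not an integer power of `p`. -/
def Generic (p z : ℂ) : Prop := z ≠ 0 ∧ ∀ m : ℤ, z * p ^ m ≠ 1

lemma Generic.sub_ne_zero {p z : ℂ} (h : Generic p z) (m : ℤ) : 1 - z * p ^ m ≠ 0 :=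
  _root_.sub_ne_zero.2 (h.2 m).symm

lemma Generic.inv {p z : ℂ} (h : Generic p z) : Generic p z⁻¹ := by
  refine ⟨inv_ne_zero h.1, fun m hm => h.2 (-m) ?_⟩
  rw [zpow_neg, ← inv_inv z, ← mul_inv, hm, inv_one]

lemma Generic.mul_zpow {p z : ℂ} (hp0 : p ≠ 0) (h : Generic p z) (k : ℤ) :
    Generic p (z * p ^ k) :=
  ⟨mul_ne_zero h.1 (zpow_ne_zero _ hp0), fun m => by
    rw [mul_assoc, ← zpow_add₀ hp0]; exact h.2 _⟩

lemma Generic.jt_mul_pfA {p z : ℂ} (hp0 : p ≠ 0) (hp : ‖p‖ < 1) (h : Generic p z) :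
    jt p z * pfA p z = thetaConst p := _root_.jt_mul_pfA hp0 hp h.1 h.2

lemma Generic.jt_ne_zero {p z : ℂ} (hp0 : p ≠ 0) (hp : ‖p‖ < 1) (hJ : thetaConst p ≠ 0)
    (h : Generic p z) : jt p z ≠ 0 := by
  rw [← h.jt_mul_pfA hp0 hp] at hJ
  exact left_ne_zero_of_mul hJ

lemma Generic.pfA_ne_zero {p z : ℂ} (hp0 : p ≠ 0) (hp : ‖p‖ < 1) (hJ : thetaConst p ≠ 0)
    (h : Generic p z) : pfA p z ≠ 0 := by
  rw [← h.jt_mul_pfA hp0 hp] at hJ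
  exact right_ne_zero_of_mul hJ

lemma Generic.pfA_eq {p z : ℂ} (hp0 : p ≠ 0) (hp : ‖p‖ < 1) (hJ : thetaConst p ≠ 0)
    (h : Generic p z) : pfA p z = thetaConst p / jt p z := by
  rw [eq_div_iff (h.jt_ne_zero hp0 hp hJ), mul_comm, h.jt_mul_pfA hp0 hp]

lemma Generic.pfA_mul_zpow {p c : ℂ} (hp0 : p ≠ 0) (hp : ‖p‖ < 1) (hJ : thetaConst p ≠ 0)
    (h : Generic p c) (a : ℤ) :
    pfA p (c * p ^ (-a)) = (-1) ^ a * c ^ (-a) * p ^ tri a * pfA p c := by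
  rw [(h.mul_zpow hp0 (-a)).pfA_eq hp0 hp hJ, h.pfA_eq hp0 hp hJ, mul_comm c, jt_zpow_mul hp0 h.1]
  have e1 : tri (-a - 1) = tri a := by
    have := tri_neg (a + 1)
    rw [tri_succ, neg_add, ← sub_eq_add_neg] at this
    rw [this]; ring
  have hj := h.jt_ne_zero hp0 hp hJ
  rw [e1, neg_neg, zpow_neg, zpow_neg, zpow_neg, ← inv_zpow (-1 : ℂ)]
  have h2 := zpow_ne_zero a h.1
  have h3 := zpow_ne_zero (tri a) hp0
  have h4 : ((-1 : ℂ) ^ a) * (-1) ^ a = 1 := by rw [← _root_.mul_zpow]; norm_num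
  have h5 : (-1 : ℂ) ^ a ≠ 0 := left_ne_zero_of_mul_eq_one h4
  rw [show (-1 : ℂ)⁻¹ = -1 by norm_num]
  generalize c ^ a = X at *
  generalize p ^ tri a = Y at *
  generalize (-1 : ℂ) ^ a = Z at *
  rw [div_eq_iff (by positivity)]
  field_simp
  linear_combination -h4

lemma Generic.pfA_inv {p c : ℂ} (hp0 : p ≠ 0) (hp : ‖p‖ < 1) (hJ : thetaConst p ≠ 0)
    (h : Generic p c) : pfA p c⁻¹ = -(c * pfA p c) := by
  rw [h.inv.pfA_eq hp0 hp hJ, h.pfA_eq hp0 hp hJ, jt_inv h.1]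
  have hj := h.jt_ne_zero hp0 hp hJ
  have := h.1
  field_simp

/-- The triple sum arising from one summand of the partial fraction identity. -/
noncomputable def pfTriple (p x y w : ℂ) (t : ℤ × ℤ × ℤ) : ℂ :=
  ((-1) ^ t.1 * p ^ tri t.1 * (1 - x * p ^ t.1)⁻¹) *
    (((-1) ^ t.2.1 * p ^ tri t.2.1 * (1 - (y / x * p ^ (-t.1)) * p ^ t.2.1)⁻¹) *
    ((-1) ^ t.2.2 * p ^ tri t.2.2 * (1 - (w / x * p ^ (-t.1)) * p ^ t.2.2)⁻¹))

lemma summable_tri {p : ℂ} (hp0 : p ≠ 0) (hp : ‖p‖ < 1) :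
    Summable fun m : ℤ => ‖(-1) ^ m * p ^ tri m‖ := by
  refine (summable_rho (ρ := ‖p‖) (by positivity) hp one_pos).congr fun n => ?_
  simp

lemma summable_pfTriple {p : ℂ} (hp0 : p ≠ 0) (hp : ‖p‖ < 1) (x y w : ℂ) :
    Summable (pfTriple p x y w) := by
  obtain ⟨C1, h1, hC1⟩ := exists_inv_bound hp0 hp x
  obtain ⟨C2, h2, hC2⟩ := exists_inv_bound hp0 hp (y / x)
  obtain ⟨C3, h3, hC3⟩ := exists_inv_bound hp0 hp (w / x)
  have hs := summable_tri hp0 hp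
  have hs3 := (hs.mul_norm (hs.mul_norm hs)).mul_right (C1 * (C2 * C3))
  refine Summable.of_norm_bounded hs3 fun t => ?_
  obtain ⟨a, b, c⟩ := t
  unfold pfTriple
  simp only
  rw [mul_assoc (y / x), ← zpow_add₀ hp0, mul_assoc (w / x), ← zpow_add₀ hp0]
  calc _ = ‖(-1) ^ a * p ^ tri a * ((-1) ^ b * p ^ tri b * ((-1) ^ c * p ^ tri c))‖ *
      (‖(1 - x * p ^ a)⁻¹‖ * (‖(1 - y / x * p ^ (-a + b))⁻¹‖ * ‖(1 - w / x * p ^ (-a + c))⁻¹‖)) := by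
        simp only [norm_mul]; ring
    _ ≤ _ := by
      gcongr
      · exact hC1 a
      · exact hC2 _
      · exact hC3 _

lemma tsum_pfTriple {p x y w : ℂ} (hp0 : p ≠ 0) (hp : ‖p‖ < 1) (hJ : thetaConst p ≠ 0)
    (hx : x ≠ 0) (hy : Generic p (y / x)) (hw : Generic p (w / x)) :
    ∑' t, pfTriple p x y w t = pfA p (y / x) * pfA p (w / x) * appell p x (x ^ 2 / (y * w)) := by
  rw [(summable_pfTriple hp0 hp x y w).tsum_prod]
  unfold appell
  rw [← tsum_mul_left]
  refine tsum_congr fun a => ?_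
  unfold pfTriple
  simp only
  rw [tsum_mul_left, ← tsum_mul_tsum_of_summable_norm (summable_pfA hp0 hp _)
    (summable_pfA hp0 hp _)]
  change _ * (pfA _ _ * pfA _ _) = _
  rw [hy.pfA_mul_zpow hp0 hp hJ, hw.pfA_mul_zpow hp0 hp hJ]
  have e : x ^ 2 / (y * w) = (y / x)⁻¹ * (w / x)⁻¹ := by
    have := hy.1; have := hw.1
    field_simp
  have h4 : ((-1 : ℂ) ^ a) * (-1) ^ a = 1 := by rw [← mul_zpow]; norm_num
  rw [e, mul_zpow, inv_zpow', inv_zpow', show 3 * tri a = tri a + tri a + tri a by ring,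
    zpow_add₀ hp0, zpow_add₀ hp0]
  generalize (y / x) ^ (-a) = X at *
  generalize (w / x) ^ (-a) = X' at *
  generalize p ^ tri a = Y at *
  generalize (1 - x * p ^ a)⁻¹ = I at *
  generalize (-1 : ℂ) ^ a = Z at *
  linear_combination (Z * Y * I * X * Y * X' * Y * pfA p (y / x) * pfA p (w / x)) * h4

lemma Generic.swap {p x y : ℂ} (h : Generic p (y / x)) : Generic p (x / y) := by
  simpa using h.inv

theorem pfA_mul_pfA_mul_pfA {p x y w : ℂ} (hp0 : p ≠ 0) (hp : ‖p‖ < 1) (hJ : thetaConst p ≠ 0)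
    (hx : Generic p x) (hy : Generic p y) (hw : Generic p w)
    (hyx : Generic p (y / x)) (hwx : Generic p (w / x)) (hwy : Generic p (w / y)) :
    pfA p x * pfA p y * pfA p w =
      pfA p (y / x) * pfA p (w / x) * appell p x (x ^ 2 / (y * w)) +
      pfA p (x / y) * pfA p (w / y) * appell p y (y ^ 2 / (x * w)) +
      pfA p (x / w) * pfA p (y / w) * appell p w (w ^ 2 / (x * y)) := by
  rw [← tsum_pfTriple hp0 hp hJ hx.1 hyx hwx, ← tsum_pfTriple hp0 hp hJ hy.1 hyx.swap hwy,
    ← tsum_pfTriple hp0 hp hJ hw.1 hwx.swap hwy.swap]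
  let e1 : ℤ × ℤ × ℤ ≃ ℤ × ℤ × ℤ :=
    ⟨fun t => (t.2.1, t.1, t.2.2), fun t => (t.2.1, t.1, t.2.2), fun _ => rfl, fun _ => rfl⟩
  let e2 : ℤ × ℤ × ℤ ≃ ℤ × ℤ × ℤ :=
    ⟨fun t => (t.2.2, t.1, t.2.1), fun t => (t.2.1, t.2.2, t.1), fun _ => rfl, fun _ => rfl⟩
  have s1 := summable_pfTriple hp0 hp x y w
  have s2 : Summable fun t => pfTriple p y x w (e1 t) := e1.summable_iff.2 (summable_pfTriple hp0 hp y x w)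
  have s3 : Summable fun t => pfTriple p w x y (e2 t) := e2.summable_iff.2 (summable_pfTriple hp0 hp w x y)
  rw [← e1.tsum_eq (pfTriple p y x w), ← e2.tsum_eq (pfTriple p w x y)]
  rw [← Summable.tsum_add s1 s2, ← Summable.tsum_add (s1.add s2) s3, mul_assoc]
  unfold pfA
  have hA := summable_pfA hp0 hp
  rw [tsum_mul_tsum_of_summable_norm (hA y) (hA w),
    tsum_mul_tsum_of_summable_norm (hA x) ((hA y).mul_norm (hA w))]
  refine tsum_congr fun t => ?_
  obtain ⟨a, b, c⟩ := t
  simp only [pfTriple, e1, e2, Equiv.coe_fn_mk]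
  have ha := zpow_ne_zero a hp0
  have hb := zpow_ne_zero b hp0
  have hc := zpow_ne_zero c hp0
  have d1 := hx.sub_ne_zero a
  have d2 := hy.sub_ne_zero b
  have d3 := hw.sub_ne_zero c
  have key : ∀ {u v : ℂ}, u ≠ 0 → v ≠ 0 → Generic p (u / v) → ∀ k l : ℤ,
      v * p ^ k - u * p ^ l ≠ 0 := by
    intro u v hu hv h k l hh
    have := h.sub_ne_zero (l - k)
    apply this
    have hk := zpow_ne_zero k hp0
    rw [zpow_sub₀ hp0]
    field_simp
    linear_combination hh
  have n1 := key hy.1 hx.1 hyx a b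
  have n2 := key hw.1 hx.1 hwx a c
  have n3 := key hw.1 hy.1 hwy b c
  have E : ∀ {u v : ℂ}, v ≠ 0 → ∀ k l : ℤ,
      (1 - u / v * p ^ (-k) * p ^ l)⁻¹ = v * p ^ k * (v * p ^ k - u * p ^ l)⁻¹ := by
    intro u v hv k l
    have hk := zpow_ne_zero k hp0
    rw [show 1 - u / v * p ^ (-k) * p ^ l = (v * p ^ k)⁻¹ * (v * p ^ k - u * p ^ l) by
      rw [zpow_neg]; field_simp, mul_inv, inv_inv]
  have neg : ∀ u v : ℂ, (u - v)⁻¹ = -(v - u)⁻¹ := fun u v => by rw [← inv_neg, neg_sub]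
  rw [E hx.1, E hx.1, E hy.1, E hy.1, E hw.1, E hw.1, neg (y * p ^ b) (x * p ^ a),
    neg (w * p ^ c) (x * p ^ a), neg (w * p ^ c) (y * p ^ b)]
  generalize x * p ^ a = X at *
  generalize y * p ^ b = Y at *
  generalize w * p ^ c = W at *
  generalize (-1 : ℂ) ^ a * p ^ tri a = T at *
  generalize (-1 : ℂ) ^ b * p ^ tri b = T2 at *
  generalize (-1 : ℂ) ^ c * p ^ tri c = T3 at *
  have main : (1 - X)⁻¹ * ((1 - Y)⁻¹ * (1 - W)⁻¹) =
      (1 - X)⁻¹ * (X * (X - Y)⁻¹ * (X * (X - W)⁻¹)) +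
      (1 - Y)⁻¹ * (Y * -(X - Y)⁻¹ * (Y * (Y - W)⁻¹)) +
      (1 - W)⁻¹ * (W * -(X - W)⁻¹ * (W * -(Y - W)⁻¹)) := by
    field_simp
    ring
  linear_combination (T * T2 * T3) * main

lemma eventually_le_norm_sub {p y₀ : ℂ} (hp0 : p ≠ 0) (hp : ‖p‖ < 1) (hy : y₀ ≠ 0) :
    ∃ c : ℝ, 0 < c ∧ ∀ᶠ y in 𝓝 y₀, ∀ m : ℤ, y₀ * p ^ m ≠ 1 → c ≤ ‖1 - y * p ^ m‖ := by
  obtain ⟨C, hC1, hC⟩ := exists_inv_bound hp0 hp y₀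
  have hy' : 0 < ‖y₀‖ := norm_pos_iff.2 hy
  refine ⟨(2 * C)⁻¹, by positivity, ?_⟩
  filter_upwards [Metric.ball_mem_nhds y₀ (show 0 < ‖y₀‖ / (2 * (C + 1)) by positivity)] with y hyb m hm
  have hd : 0 < ‖1 - y₀ * p ^ m‖ := norm_pos_iff.2 (sub_ne_zero.2 hm.symm)
  have h1 : 1 ≤ C * ‖1 - y₀ * p ^ m‖ := by
    have := hC m
    rw [norm_inv, inv_le_iff_one_le_mul₀ hd] at this
    exact this
  have h2 : ‖y₀‖ * ‖p ^ m‖ ≤ (C + 1) * ‖1 - y₀ * p ^ m‖ := by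
    rw [← norm_mul]
    calc ‖y₀ * p ^ m‖ = ‖1 - (1 - y₀ * p ^ m)‖ := by ring_nf
      _ ≤ ‖(1 : ℂ)‖ + ‖1 - y₀ * p ^ m‖ := norm_sub_le _ _
      _ ≤ _ := by rw [norm_one]; linarith
  have h3 : ‖y - y₀‖ * (2 * (C + 1)) ≤ ‖y₀‖ := by
    rw [Metric.mem_ball, dist_eq_norm, lt_div_iff₀ (by positivity)] at hyb
    exact hyb.le
  have h4 : ‖(y - y₀) * p ^ m‖ ≤ ‖1 - y₀ * p ^ m‖ / 2 := by
    rw [norm_mul]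
    have : (‖y - y₀‖ * (2 * (C + 1))) * ‖p ^ m‖ ≤ (C + 1) * ‖1 - y₀ * p ^ m‖ :=
      (mul_le_mul_of_nonneg_right h3 (norm_nonneg _)).trans h2
    have h5 : (C + 1) * (2 * (‖y - y₀‖ * ‖p ^ m‖)) ≤ (C + 1) * ‖1 - y₀ * p ^ m‖ := by
      linarith
    have := le_of_mul_le_mul_left h5 (by linarith)
    linarith
  have h5 : ‖1 - y₀ * p ^ m‖ ≤ ‖1 - y * p ^ m‖ + ‖(y - y₀) * p ^ m‖ := by
    refine le_trans (le_of_eq ?_) (norm_add_le _ _)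
    ring_nf
  rw [inv_le_iff_one_le_mul₀ (by positivity)]
  nlinarith

lemma continuousAt_polar {p y₀ : ℂ} (hp0 : p ≠ 0) (hp : ‖p‖ < 1) (hy : y₀ ≠ 0) {f : ℤ → ℂ}
    (hf : Summable fun m => ‖f m‖) (h0 : ∀ m, y₀ * p ^ m = 1 → f m = 0) :
    ContinuousAt (fun y => ∑' m, f m * (1 - y * p ^ m)⁻¹) y₀ := by
  obtain ⟨c, hc0, hc⟩ := eventually_le_norm_sub hp0 hp hy
  refine tendsto_tsum_of_dominated_convergence (hf.mul_right c⁻¹) (fun m => ?_) ?_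
  · by_cases hm : y₀ * p ^ m = 1
    · simp [h0 m hm]
    · refine Tendsto.const_mul _ (Tendsto.inv₀ ?_ (sub_ne_zero.2 (Ne.symm hm)))
      exact tendsto_const_nhds.sub (tendsto_id.mul_const _)
  · filter_upwards [hc] with y hy m
    by_cases hm : y₀ * p ^ m = 1
    · simp [h0 m hm]
    · rw [norm_mul, norm_inv]
      gcongr
      exact hy m hm

lemma Generic.eventually {p z : ℂ} (hp0 : p ≠ 0) (hp : ‖p‖ < 1) (h : Generic p z) :
    ∀ᶠ y in 𝓝 z, Generic p y := by
  obtain ⟨c, hc0, hc⟩ := eventually_le_norm_sub hp0 hp h.1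
  filter_upwards [hc, eventually_ne_nhds h.1] with y hy hy0
  refine ⟨hy0, fun m hm => ?_⟩
  have := hy m (h.2 m)
  rw [hm] at this
  simp at this
  linarith

lemma zpow_ne_one_of_ne {p : ℂ} (hp : ‖p‖ < 1) {m : ℤ} (hm : m ≠ 0) :
    p ^ m ≠ 1 := by
  intro h
  have h1 : ‖p‖ ^ m = 1 := by rw [← norm_zpow, h, norm_one]
  rcases (zpow_eq_one_iff_of_ne_zero₀ hm).1 h1 with h2 | h2
  · exact hp.ne h2
  · have := norm_nonneg p
    linarith [h2.1]

lemma eventually_generic_one {p : ℂ} (hp0 : p ≠ 0) (hp : ‖p‖ < 1) :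
    ∀ᶠ y in 𝓝[≠] (1 : ℂ), Generic p y := by
  obtain ⟨c, hc0, hc⟩ := eventually_le_norm_sub hp0 hp one_ne_zero
  filter_upwards [hc.filter_mono nhdsWithin_le_nhds, (eventually_ne_nhds one_ne_zero).filter_mono nhdsWithin_le_nhds, self_mem_nhdsWithin]
    with y hy hy0 hy1
  refine ⟨hy0, fun m hm => ?_⟩
  rcases eq_or_ne m 0 with rfl | hm0
  · simp at hm; exact hy1 hm
  have := hy m (by rw [one_mul]; exact zpow_ne_one_of_ne hp hm0)
  rw [hm] at this
  simp at this
  linarith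

lemma tsum_polar_eq {p : ℂ} (hp0 : p ≠ 0) (hp : ‖p‖ < 1) {f : ℤ → ℂ}
    (hf : Summable fun m => ‖f m‖) (w : ℂ) :
    ∑' m, f m * (1 - w * p ^ m)⁻¹ =
      f 0 * (1 - w)⁻¹ + ∑' m, (if m = 0 then 0 else f m) * (1 - w * p ^ m)⁻¹ := by
  rw [(hf.mul_inv_bound hp0 hp w).of_norm.tsum_eq_add_tsum_ite 0]
  simp [ite_mul]

lemma pfA_one {p : ℂ} (hp0 : p ≠ 0) : pfA p 1 = 0 := by
  rw [← self_eq_neg]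
  unfold pfA
  rw [← tsum_neg, ← (Equiv.neg ℤ).tsum_eq]
  refine tsum_congr fun m => ?_
  simp only [Equiv.neg_apply, one_mul]
  have hP := zpow_ne_zero m hp0
  rw [tri_neg, zpow_sub₀ hp0, zpow_neg p, zpow_neg (-1 : ℂ), ← inv_zpow (-1 : ℂ),
    show (-1 : ℂ)⁻¹ = -1 by norm_num,
    show (1 - (p ^ m)⁻¹) = -((p ^ m)⁻¹ * (1 - p ^ m)) by field_simp; ring, inv_neg, mul_inv, inv_inv]
  generalize p ^ m = P at *
  field_simp

lemma hasDerivAt_jt {p x : ℂ} (hp0 : p ≠ 0) (hp : ‖p‖ < 1) (hx : x ≠ 0) :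
    HasDerivAt (jt p) (deriv (jt p) x) x := (jt_differentiableAt hp0 hp hx).hasDerivAt

lemma hasDerivAt_jt_mul {p x : ℂ} (hp0 : p ≠ 0) (hp : ‖p‖ < 1) (hx : x ≠ 0) :
    HasDerivAt (fun w => jt p (x * w)) (x * deriv (jt p) x) 1 := by
  have e1 : HasDerivAt (jt p) (deriv (jt p) x) (x * 1) := by
    rw [mul_one]; exact hasDerivAt_jt hp0 hp hx
  have e2 : HasDerivAt (fun w : ℂ => x * w) x 1 := by
    simpa using (hasDerivAt_id (1 : ℂ)).const_mul x
  rw [mul_comm]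
  exact e1.comp 1 e2

lemma tendsto_polar_one {p : ℂ} (hp0 : p ≠ 0) (hp : ‖p‖ < 1) {f : ℤ → ℂ}
    (hf : Summable fun m => ‖f m‖) :
    Tendsto (fun w => ∑' m, (if m = 0 then 0 else f m) * (1 - w * p ^ m)⁻¹) (𝓝[≠] 1)
      (𝓝 (∑' m, f m * (1 - 1 * p ^ m)⁻¹)) := by
  rw [tsum_polar_eq hp0 hp hf 1, sub_self, inv_zero, mul_zero, zero_add]
  refine (continuousAt_polar hp0 hp one_ne_zero
    (f := fun m => if m = 0 then 0 else f m) ?_ ?_).tendsto.mono_left nhdsWithin_le_nhds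
  · refine Summable.of_nonneg_of_le (fun _ => norm_nonneg _) (fun m => ?_) hf
    split_ifs
    · simp
    · exact le_rfl
  · intro m hm
    rw [one_mul] at hm
    rw [if_pos]
    by_contra h
    exact zpow_ne_one_of_ne hp h hm

lemma pfA_eq_add {p : ℂ} (hp0 : p ≠ 0) (hp : ‖p‖ < 1) (w : ℂ) :
    pfA p w = (1 - w)⁻¹ +
      ∑' m : ℤ, (if m = 0 then 0 else (-1) ^ m * p ^ tri m) * (1 - w * p ^ m)⁻¹ := by
  unfold pfA
  rw [tsum_polar_eq hp0 hp (summable_tri hp0 hp) w]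
  simp [tri_zero]

/-- The logarithmic derivative of the theta function. -/
noncomputable def thetaLog (p x : ℂ) : ℂ := x * deriv (jt p) x / jt p x

theorem appell_one {p ζ : ℂ} (hp0 : p ≠ 0) (hp : ‖p‖ < 1) (hJ : thetaConst p ≠ 0)
    (h1 : Generic p ζ) (h2 : Generic p (ζ ^ 2)) :
    ζ ^ 3 * appell p (ζ ^ 2) (ζ ^ 3) + appell p 1 (ζ ^ 3)⁻¹ =
      ζ * pfA p ζ / pfA p (ζ ^ 2) * appell p ζ 1 + (thetaLog p ζ + thetaLog p (ζ ^ 2)) := by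
  have hζ := h1.1
  have hζ2 := h2.1
  have j1 := h1.jt_ne_zero hp0 hp hJ
  have j2 := h2.jt_ne_zero hp0 hp hJ
  set G : ℂ → ℂ := fun w => thetaConst p / jt p (ζ * w) * (thetaConst p / jt p (ζ ^ 2 * w)) with hG
  have hGd : HasDerivAt G (-(pfA p ζ * pfA p (ζ ^ 2) * (thetaLog p ζ + thetaLog p (ζ ^ 2)))) 1 := by
    have d1 := (hasDerivAt_const (1 : ℂ) (thetaConst p)).div (hasDerivAt_jt_mul hp0 hp hζ) (by rwa [mul_one])
    have d2 := (hasDerivAt_const (1 : ℂ) (thetaConst p)).div (hasDerivAt_jt_mul hp0 hp hζ2) (by rwa [mul_one])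
    have d3 : HasDerivAt G _ 1 := d1.mul d2
    refine d3.congr_deriv ?_
    simp only [mul_one, Pi.div_apply]
    rw [h1.pfA_eq hp0 hp hJ, h2.pfA_eq hp0 hp hJ]
    unfold thetaLog
    field_simp
    ring
  have hslope := (hasDerivAt_iff_tendsto_slope.1 hGd)
  have hG1 : G 1 = pfA p ζ * pfA p (ζ ^ 2) := by
    simp only [hG, mul_one]
    rw [h1.pfA_eq hp0 hp hJ, h2.pfA_eq hp0 hp hJ]
  have hcoef : ∀ {s : ℂ}, s ≠ 0 → Summable fun m : ℤ => ‖(-1) ^ m * p ^ (3 * tri m) * s ^ m‖ :=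
    fun hs => summable_appell_coeff hp0 hp hs
  have hmulc : ∀ x : ℂ, Tendsto (fun w : ℂ => x * w) (𝓝[≠] 1) (𝓝 x) := fun x => by
    have : Tendsto (fun w : ℂ => x * w) (𝓝 1) (𝓝 (x * 1)) := tendsto_const_nhds.mul tendsto_id
    rw [mul_one] at this
    exact this.mono_left nhdsWithin_le_nhds
  have hap : ∀ {x s : ℂ}, Generic p x → s ≠ 0 →
      Tendsto (fun w => appell p (x * w) s) (𝓝[≠] 1) (𝓝 (appell p x s)) := by
    intro x s hx hs
    have := continuousAt_polar hp0 hp hx.1 (hcoef hs) (fun m hm => absurd hm (hx.2 m))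
    exact Tendsto.comp this (hmulc x)
  have hA := tendsto_polar_one hp0 hp (summable_tri hp0 hp)
  have hA1 : ∑' m : ℤ, (-1) ^ m * p ^ tri m * (1 - 1 * p ^ m)⁻¹ = 0 := pfA_one hp0
  rw [hA1] at hA
  have hL := tendsto_polar_one hp0 hp (hcoef (inv_ne_zero (pow_ne_zero 3 hζ)))
  have hGc : Tendsto G (𝓝[≠] 1) (𝓝 (G 1)) := hGd.continuousAt.tendsto.mono_left nhdsWithin_le_nhds
  have lim1 := hslope.neg.add (hGc.mul hA)
  have lim2 := ((hap h1 one_ne_zero).const_mul (-(ζ * pfA p ζ ^ 2))).add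
    (((((hap h2 (pow_ne_zero 3 hζ)).const_mul (ζ ^ 3)).add hL)).const_mul (G 1))
  have heq := tendsto_nhds_unique_of_eventuallyEq lim1 lim2 ?_
  · rw [hG1, mul_zero, add_zero, neg_neg] at heq
    have a1 := h1.pfA_ne_zero hp0 hp hJ
    have a2 := h2.pfA_ne_zero hp0 hp hJ
    change _ = _ + _ * (_ + appell p 1 (ζ ^ 3)⁻¹) at heq
    apply mul_left_cancel₀ (mul_ne_zero a1 a2)
    field_simp at heq ⊢
    linear_combination -heq
  · filter_upwards [eventually_generic_one hp0 hp, (hmulc ζ).eventually (h1.eventually hp0 hp),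
      (hmulc (ζ ^ 2)).eventually (h2.eventually hp0 hp), self_mem_nhdsWithin] with w hw hw1 hw2 hne
    have hw0 := hw.1
    have hGw : G w = pfA p (ζ * w) * pfA p (ζ ^ 2 * w) := by
      simp only [hG]
      rw [hw1.pfA_eq hp0 hp hJ, hw2.pfA_eq hp0 hp hJ]
    have r1 : ζ ^ 2 * w / (ζ * w) = ζ := by field_simp
    have r2 : w / (ζ * w) = ζ⁻¹ := by field_simp
    have r3 : w / (ζ ^ 2 * w) = (ζ ^ 2)⁻¹ := by field_simp
    have r4 : ζ * w / (ζ ^ 2 * w) = ζ⁻¹ := by field_simp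
    have r5 : ζ * w / w = ζ := by field_simp
    have r6 : ζ ^ 2 * w / w = ζ ^ 2 := by field_simp
    have key := pfA_mul_pfA_mul_pfA hp0 hp hJ hw1 hw2 hw (by rw [r1]; exact h1)
      (by rw [r2]; exact h1.inv) (by rw [r3]; exact h2.inv)
    rw [r1, r2, r3, r4, r5, r6, h1.pfA_inv hp0 hp hJ, h2.pfA_inv hp0 hp hJ,
      show (ζ * w) ^ 2 / (ζ ^ 2 * w * w) = 1 by field_simp,
      show (ζ ^ 2 * w) ^ 2 / (ζ * w * w) = ζ ^ 3 by field_simp,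
      show w ^ 2 / (ζ * w * (ζ ^ 2 * w)) = (ζ ^ 3)⁻¹ by field_simp] at key
    have e2 : appell p w (ζ ^ 3)⁻¹ = (1 - w)⁻¹ + ∑' m : ℤ, (if m = 0 then 0 else
        (-1) ^ m * p ^ (3 * tri m) * ((ζ ^ 3)⁻¹) ^ m) * (1 - w * p ^ m)⁻¹ := by
      unfold appell
      rw [tsum_polar_eq hp0 hp (hcoef (inv_ne_zero (pow_ne_zero 3 hζ))) w]
      simp [tri_zero]
    rw [pfA_eq_add hp0 hp w, e2] at key
    have hs : slope G 1 w = -((G w - G 1) * (1 - w)⁻¹) := by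
      rw [slope_def_field, ← neg_sub 1 w, div_neg, div_eq_mul_inv]
    rw [hs]
    rw [hG1] at *
    rw [hGw]
    linear_combination key

lemma tsum_eq_add_of_bijective {α α' β : Type*} {f : β → ℂ} (hf : Summable f) {g₁ : α → β}
    {g₂ : α' → β} (hg : Function.Bijective (Sum.elim g₁ g₂)) :
    ∑' b, f b = ∑' a, f (g₁ a) + ∑' a, f (g₂ a) := by
  have h1 : Function.Injective g₁ := hg.1.comp Sum.inl_injective
  have h2 : Function.Injective g₂ := hg.1.comp Sum.inr_injective
  rw [← (Equiv.ofBijective _ hg).tsum_eq f]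
  exact (HasSum.sum (f := fun x => f (Sum.elim g₁ g₂ x)) (hf.comp_injective h1).hasSum
    (hf.comp_injective h2).hasSum).tsum_eq

/-- The theta series with even exponents. -/
noncomputable def thetaEven (p x : ℂ) : ℂ := ∑' a : ℤ, p ^ (a * a) * x ^ (2 * a)

/-- The theta series with odd exponents. -/
noncomputable def thetaOdd (p x : ℂ) : ℂ := ∑' a : ℤ, p ^ (a * a + a) * x ^ (2 * a + 1)

lemma summable_thetaEven {p x : ℂ} (hp0 : p ≠ 0) (hp : ‖p‖ < 1) (hx : x ≠ 0) :
    Summable fun a : ℤ => ‖p ^ (a * a) * x ^ (2 * a)‖ := by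
  refine (summable_rho (ρ := ‖p‖ ^ 2) (B := ‖p‖⁻¹ * ‖x‖ ^ 2) (by positivity)
    (pow_lt_one₀ (norm_nonneg _) hp (by norm_num)) (by positivity)).congr fun a => ?_
  have h : a * a = 2 * tri a - a := by rw [two_mul_tri]; ring
  rw [h, zpow_sub₀ hp0, zpow_mul, mul_zpow, zpow_mul x, inv_zpow]
  simp
  ring

lemma summable_thetaOdd {p x : ℂ} (hp0 : p ≠ 0) (hp : ‖p‖ < 1) (hx : x ≠ 0) :
    Summable fun a : ℤ => ‖p ^ (a * a + a) * x ^ (2 * a + 1)‖ := by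
  refine ((summable_rho (ρ := ‖p‖ ^ 2) (B := ‖x‖ ^ 2) (by positivity)
    (pow_lt_one₀ (norm_nonneg _) hp (by norm_num)) (by positivity)).mul_right ‖x‖).congr fun a => ?_
  have h : a * a + a = 2 * tri a := by rw [two_mul_tri]; ring
  rw [h, zpow_mul, zpow_add_one₀ hx, zpow_mul x]
  simp
  ring

theorem jt_mul_jt {p x y : ℂ} (hp0 : p ≠ 0) (hp : ‖p‖ < 1) (hx : x ≠ 0) (hy : y ≠ 0) :
    jt p (x * y) * jt p (x / y) =
      x * (thetaOdd p x * thetaEven p y - thetaEven p x * thetaOdd p y) := by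
  have hxy := mul_ne_zero hx hy
  have hxy' := div_ne_zero hx hy
  have hs := summable_mul_of_summable_norm (summable_theta hp0 hp hxy) (summable_theta hp0 hp hxy')
  unfold jt
  rw [tsum_mul_tsum_of_summable_norm (summable_theta hp0 hp hxy) (summable_theta hp0 hp hxy'),
    tsum_eq_add_of_bijective hs (g₁ := fun t : ℤ × ℤ => (t.1 + t.2 + 1, t.1 - t.2 + 1))
      (g₂ := fun t : ℤ × ℤ => (t.1 + t.2 + 1, t.1 - t.2))]
  · unfold thetaOdd thetaEven
    rw [tsum_mul_tsum_of_summable_norm (summable_thetaOdd hp0 hp hx) (summable_thetaEven hp0 hp hy),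
      tsum_mul_tsum_of_summable_norm (summable_thetaEven hp0 hp hx) (summable_thetaOdd hp0 hp hy),
      sub_eq_add_neg, ← tsum_neg, mul_add, ← tsum_mul_left, ← tsum_mul_left]
    have sgn : ∀ a : ℤ, (-1 : ℂ) ^ (2 * a) = 1 := fun a => by rw [zpow_mul]; norm_num
    congr 1
    · refine tsum_congr fun t => ?_
      obtain ⟨a, b⟩ := t
      simp only [theta]
      have e : tri (a + b + 1 - 1) + tri (a - b + 1 - 1) = (a * a + a) + b * b := by
        have h1 := two_mul_tri (a + b + 1 - 1)
        have h2 := two_mul_tri (a - b + 1 - 1)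
        apply mul_left_cancel₀ (two_ne_zero : (2 : ℤ) ≠ 0)
        linear_combination h1 + h2
      have e2 : (-1 : ℂ) ^ (a + b + 1) * (-1) ^ (a - b + 1) = 1 := by
        rw [← zpow_add₀ (by norm_num), show a + b + 1 + (a - b + 1) = 2 * (a + 1) by ring, sgn]
      have e3 : (x * y) ^ (a + b + 1) * (x / y) ^ (a - b + 1) = x ^ (2 * a + 1) * x * y ^ (2 * b) := by
        have f1 : x ^ (2 * a + 1) * x = x ^ (a + b + 1) * x ^ (a - b + 1) := by
          rw [← zpow_add_one₀ hx, ← zpow_add₀ hx]; congr 1; ring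
        have f2 : y ^ (2 * b) = y ^ (a + b + 1) / y ^ (a - b + 1) := by
          rw [← zpow_sub₀ hy]; congr 1; ring
        rw [mul_zpow, div_zpow, f1, f2]
        ring
      have e4 : p ^ tri (a + b + 1 - 1) * p ^ tri (a - b + 1 - 1) = p ^ (a * a + a) * p ^ (b * b) := by
        rw [← zpow_add₀ hp0, ← zpow_add₀ hp0, e]
      calc _ = ((-1 : ℂ) ^ (a + b + 1) * (-1) ^ (a - b + 1)) *
          (p ^ tri (a + b + 1 - 1) * p ^ tri (a - b + 1 - 1)) *
          ((x * y) ^ (a + b + 1) * (x / y) ^ (a - b + 1)) := by ring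
        _ = _ := by rw [e2, e3, e4]; ring
    · refine tsum_congr fun t => ?_
      obtain ⟨a, b⟩ := t
      simp only [theta]
      have e : tri (a + b + 1 - 1) + tri (a - b - 1) = a * a + (b * b + b) := by
        have h1 := two_mul_tri (a + b + 1 - 1)
        have h2 := two_mul_tri (a - b - 1)
        apply mul_left_cancel₀ (two_ne_zero : (2 : ℤ) ≠ 0)
        linear_combination h1 + h2
      have e2 : (-1 : ℂ) ^ (a + b + 1) * (-1) ^ (a - b) = -1 := by
        rw [← zpow_add₀ (by norm_num), show a + b + 1 + (a - b) = 2 * a + 1 by ring,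
          zpow_add_one₀ (by norm_num), sgn]; norm_num
      have e3 : (x * y) ^ (a + b + 1) * (x / y) ^ (a - b) = x ^ (2 * a) * x * y ^ (2 * b + 1) := by
        have f1 : x ^ (2 * a) * x = x ^ (a + b + 1) * x ^ (a - b) := by
          rw [← zpow_add_one₀ hx, ← zpow_add₀ hx]; congr 1; ring
        have f2 : y ^ (2 * b + 1) = y ^ (a + b + 1) / y ^ (a - b) := by
          rw [← zpow_sub₀ hy]; congr 1; ring
        rw [mul_zpow, div_zpow, f1, f2]
        ring
      have e4 : p ^ tri (a + b + 1 - 1) * p ^ tri (a - b - 1) = p ^ (a * a) * p ^ (b * b + b) := by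
        rw [← zpow_add₀ hp0, ← zpow_add₀ hp0, e]
      calc _ = ((-1 : ℂ) ^ (a + b + 1) * (-1) ^ (a - b)) *
          (p ^ tri (a + b + 1 - 1) * p ^ tri (a - b - 1)) *
          ((x * y) ^ (a + b + 1) * (x / y) ^ (a - b)) := by ring
        _ = _ := by rw [e2, e3, e4]; ring
  · constructor
    · rintro (⟨a, b⟩ | ⟨a, b⟩) (⟨c, d⟩ | ⟨c, d⟩) h <;> simp at h ⊢ <;> omega
    · rintro ⟨m, n⟩
      rcases Int.even_or_odd' (m + n) with ⟨k, hk | hk⟩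
      · refine ⟨Sum.inl (k - 1, m - k), ?_⟩
        simp; omega
      · refine ⟨Sum.inr (k, m - k - 1), ?_⟩
        simp; omega

/-- The Weierstrass three-term relation. -/
theorem jt_three_term {p x y u v : ℂ} (hp0 : p ≠ 0) (hp : ‖p‖ < 1) (hx : x ≠ 0) (hy : y ≠ 0)
    (hu : u ≠ 0) (hv : v ≠ 0) :
    jt p (x * y) * jt p (x / y) * (jt p (u * v) * jt p (u / v)) -
      jt p (x * v) * jt p (x / v) * (jt p (u * y) * jt p (u / y)) =
      u / y * (jt p (y * v) * jt p (y / v)) * (jt p (x * u) * jt p (x / u)) := by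
  rw [jt_mul_jt hp0 hp hx hy, jt_mul_jt hp0 hp hu hv, jt_mul_jt hp0 hp hx hv, jt_mul_jt hp0 hp hu hy,
    jt_mul_jt hp0 hp hy hv, jt_mul_jt hp0 hp hx hu]
  field_simp
  ring

lemma deriv_jt_one {p : ℂ} (hp0 : p ≠ 0) (hp : ‖p‖ < 1) :
    deriv (jt p) 1 = -thetaConst p := by
  have hd := hasDerivAt_jt hp0 hp one_ne_zero
  have h1 := hasDerivAt_iff_tendsto_slope.1 hd
  have hA := tendsto_polar_one hp0 hp (summable_tri hp0 hp)
  rw [show ∑' m : ℤ, (-1) ^ m * p ^ tri m * (1 - 1 * p ^ m)⁻¹ = 0 from pfA_one hp0] at hA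
  have hj : Tendsto (jt p) (𝓝[≠] 1) (𝓝 (jt p 1)) :=
    hd.continuousAt.tendsto.mono_left nhdsWithin_le_nhds
  have h2 := h1.neg.add (hj.mul hA)
  rw [mul_zero, add_zero] at h2
  have h3 : Tendsto (fun _ : ℂ => thetaConst p) (𝓝[≠] 1) (𝓝 (thetaConst p)) := tendsto_const_nhds
  rw [← tendsto_nhds_unique_of_eventuallyEq h2 h3 ?_, neg_neg]
  filter_upwards [eventually_generic_one hp0 hp] with w hw
  rw [← hw.jt_mul_pfA hp0 hp, pfA_eq_add hp0 hp, slope_def_field, jt_one, ← neg_sub 1 w, div_neg,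
    div_eq_mul_inv]
  ring

lemma thetaLog_inv {p x : ℂ} (hp0 : p ≠ 0) (hp : ‖p‖ < 1) (hx : x ≠ 0) (hj : jt p x ≠ 0) :
    thetaLog p x⁻¹ = 1 - thetaLog p x := by
  have h1 := (hasDerivAt_jt hp0 hp (inv_ne_zero hx)).comp x (hasDerivAt_inv hx)
  have h2 := ((hasDerivAt_inv hx).mul (hasDerivAt_jt hp0 hp hx)).neg
  have heq : (jt p ∘ fun y => y⁻¹) =ᶠ[𝓝 x] fun y => -(y⁻¹ * jt p y) := by
    filter_upwards [eventually_ne_nhds hx] with y hy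
    exact jt_inv hy
  have h3 := (h1.congr_of_eventuallyEq heq.symm).unique h2
  unfold thetaLog
  rw [jt_inv hx]
  field_simp at h3 ⊢
  linear_combination h3

lemma thetaLog_mul {p x : ℂ} (hp0 : p ≠ 0) (hp : ‖p‖ < 1) (hx : x ≠ 0) (hj : jt p x ≠ 0) :
    thetaLog p (p * x) = thetaLog p x - 1 := by
  have h0 : HasDerivAt (fun y : ℂ => p * y) p x := by
    simpa using (hasDerivAt_id x).const_mul p
  have h1 := (hasDerivAt_jt hp0 hp (mul_ne_zero hp0 hx)).comp x h0
  have h2 := ((hasDerivAt_inv hx).mul (hasDerivAt_jt hp0 hp hx)).neg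
  have heq : (jt p ∘ fun y => p * y) =ᶠ[𝓝 x] fun y => -(y⁻¹ * jt p y) := by
    filter_upwards [eventually_ne_nhds hx] with y hy
    exact jt_mul hp0 hy
  have h3 := (h1.congr_of_eventuallyEq heq.symm).unique h2
  unfold thetaLog
  rw [jt_mul hp0 hx]
  field_simp at h3 ⊢
  linear_combination (-1) * h3

theorem thetaLog_add_sub {p y u v : ℂ} (hp0 : p ≠ 0) (hp : ‖p‖ < 1) (hy : y ≠ 0)
    (hu : u ≠ 0) (hv : v ≠ 0) (h1 : jt p (u * y) ≠ 0) (h2 : jt p (u / y) ≠ 0)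
    (h3 : jt p (u * v) ≠ 0) (h4 : jt p (u / v) ≠ 0) :
    (thetaLog p (u * y) + thetaLog p (u / y) - thetaLog p (u * v) - thetaLog p (u / v)) *
      (jt p (u * y) * jt p (u / y) * (jt p (u * v) * jt p (u / v))) =
      -(u / y * thetaConst p * (jt p (y * v) * jt p (y / v)) * jt p (u ^ 2)) := by
  have d := fun {x : ℂ} (hx : x ≠ 0) => hasDerivAt_jt_mul hp0 hp hx
  have dl := ((((d (mul_ne_zero hu hy)).mul (d (div_ne_zero hu hy))).mul_const
    (jt p (u * v) * jt p (u / v))).sub (((d (mul_ne_zero hu hv)).mul (d (div_ne_zero hu hv))).mul_const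
    (jt p (u * y) * jt p (u / y))))
  have dr := ((d (pow_ne_zero 2 hu)).mul (hasDerivAt_jt hp0 hp one_ne_zero)).const_mul
    (u / y * (jt p (y * v) * jt p (y / v)))
  have heq := (dr.congr_of_eventuallyEq (f₁ := _) ?_).unique dl
  · simp only [mul_one] at heq
    rw [jt_one, deriv_jt_one hp0 hp] at heq
    unfold thetaLog
    generalize deriv (jt p) (u * y) = d1 at *
    generalize deriv (jt p) (u / y) = d2 at *
    generalize deriv (jt p) (u * v) = d3 at *
    generalize deriv (jt p) (u / v) = d4 at *
    generalize jt p (u * y) = j1 at *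
    generalize jt p (u / y) = j2 at *
    generalize jt p (u * v) = j3 at *
    generalize jt p (u / v) = j4 at *
    have : ∀ a b c e : ℂ, (a / j1 + b / j2 - c / j3 - e / j4) * (j1 * j2 * (j3 * j4)) =
        a * j2 * (j3 * j4) + j1 * b * (j3 * j4) - (c * j4 + j3 * e) * (j1 * j2) := by
      intro a b c e; field_simp; ring
    rw [this]
    linear_combination -heq
  · filter_upwards [eventually_ne_nhds one_ne_zero] with w hw
    have := jt_three_term hp0 hp (mul_ne_zero hu hw) hy hu hv
    simp only [Pi.sub_apply, Pi.mul_apply]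
    rw [show u * w * y = u * y * w by ring, show u * w / y = u / y * w by ring,
      show u * w * v = u * v * w by ring, show u * w / v = u / v * w by ring,
      show u * w * u = u ^ 2 * w by ring, show u * w / u = w by field_simp] at this
    exact this

/-- Euler's pentagonal number series. -/
noncomputable def pentSeries (p : ℂ) : ℂ := ∑' m : ℤ, (-1) ^ m * p ^ (3 * tri m - m)

/-- The two-term series of the quintuple product identity. -/
noncomputable def quintSeries (p x : ℂ) : ℂ :=
  ∑' n : ℤ, (-1) ^ n * p ^ (3 * tri n - n) * (x ^ (3 * n) + x ^ (-3 * n - 1))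

lemma neg_one_zpow_eq_of_even {a b : ℤ} (h : Even (a - b)) : (-1 : ℂ) ^ a = (-1) ^ b := by
  rw [← sub_add_cancel a b, zpow_add₀ (by norm_num), h.neg_one_zpow, one_mul]

lemma neg_one_zpow_eq_neg {a b : ℤ} (h : Odd (a - b)) : (-1 : ℂ) ^ a = -(-1) ^ b := by
  rw [← sub_add_cancel a b, zpow_add₀ (by norm_num), h.neg_one_zpow, neg_one_mul]

lemma summable_pent {p x : ℂ} (hp0 : p ≠ 0) (hp : ‖p‖ < 1) (hx : x ≠ 0) :
    Summable fun m : ℤ => ‖(-1) ^ m * p ^ (3 * tri m - m) * x ^ m‖ := by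
  refine (summable_appell_coeff hp0 hp (s := p⁻¹ * x) (by positivity)).congr fun m => ?_
  rw [zpow_sub₀ hp0, mul_zpow, inv_zpow, div_eq_mul_inv]
  congr 1; ring

lemma summable_pent_one {p : ℂ} (hp0 : p ≠ 0) (hp : ‖p‖ < 1) :
    Summable fun m : ℤ => ‖(-1) ^ m * p ^ (3 * tri m - m)‖ := by
  simpa using summable_pent hp0 hp one_ne_zero

lemma tsum_int_parity {f : ℤ → ℂ} (hf : Summable f) :
    ∑' n, f n = ∑' n : ℤ, f (2 * n) + ∑' n : ℤ, f (2 * n - 1) := by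
  refine tsum_eq_add_of_bijective hf ⟨?_, fun n => ?_⟩
  · rintro (a | a) (b | b) h <;> simp at h ⊢ <;> omega
  · rcases Int.even_or_odd' n with ⟨k, rfl | rfl⟩
    · exact ⟨Sum.inl k, rfl⟩
    · exact ⟨Sum.inr (k + 1), by simp; ring⟩

/-- The quintuple product identity, in multiplied-out form. -/
theorem jt_mul_quintSeries {p x : ℂ} (hp0 : p ≠ 0) (hp : ‖p‖ < 1) (hx : x ≠ 0) :
    jt p x * quintSeries p x = x⁻¹ * pentSeries p * jt p (x ^ 2) := by
  have hθ := summable_theta hp0 hp hx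
  set v : ℤ → ℂ := fun n => (-1) ^ n * p ^ (3 * tri n - n) with hv
  have hv1 : Summable fun n => ‖v n * x ^ (3 * n)‖ := by
    refine (summable_pent hp0 hp (pow_ne_zero 3 hx)).congr fun n => ?_
    simp only [hv]
    rw [zpow_mul, show x ^ (3 : ℤ) = x ^ 3 from zpow_ofNat x 3]
  have hv2 : Summable fun n => ‖v n * x ^ (-3 * n - 1)‖ := by
    refine ((summable_pent hp0 hp (inv_ne_zero (pow_ne_zero 3 hx))).mul_right ‖x⁻¹‖).congr
      fun n => ?_
    rw [← norm_mul, zpow_sub_one₀ hx, neg_mul, zpow_neg, zpow_mul, inv_zpow, mul_assoc,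
      show x ^ (3 : ℤ) = x ^ 3 from zpow_ofNat x 3]
  let e1 : ℤ × ℤ ≃ ℤ × ℤ := ⟨fun t => (t.1 - 3 * t.2, t.2), fun t => (t.1 + 3 * t.2, t.2),
    fun _ => by simp, fun _ => by simp⟩
  let e2 : ℤ × ℤ ≃ ℤ × ℤ := ⟨fun t => (t.1 + 3 * t.2 + 1, t.2), fun t => (t.1 - 3 * t.2 - 1, t.2),
    fun _ => by ext <;> simp; ring, fun _ => by ext <;> simp; ring⟩
  have s1 : Summable fun t : ℤ × ℤ => x ^ t.1 * (theta p (t.1 - 3 * t.2) * v t.2) := by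
    refine (e1.summable_iff.2 (summable_mul_of_summable_norm hθ hv1)).congr fun t => ?_
    simp only [Function.comp, e1, Equiv.coe_fn_mk]
    rw [show x ^ t.1 = x ^ (t.1 - 3 * t.2) * x ^ (3 * t.2) by rw [← zpow_add₀ hx]; simp]
    ring
  have s2 : Summable fun t : ℤ × ℤ => x ^ t.1 * (theta p (t.1 + 3 * t.2 + 1) * v t.2) := by
    refine (e2.summable_iff.2 (summable_mul_of_summable_norm hθ hv2)).congr fun t => ?_
    simp only [Function.comp, e2, Equiv.coe_fn_mk]
    rw [show x ^ t.1 = x ^ (t.1 + 3 * t.2 + 1) * x ^ (-3 * t.2 - 1) by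
      rw [← zpow_add₀ hx]; congr 1; ring]
    ring
  have t1 : jt p x * ∑' n, v n * x ^ (3 * n) =
      ∑' N : ℤ, ∑' n : ℤ, x ^ N * (theta p (N - 3 * n) * v n) := by
    rw [← s1.tsum_prod, jt, tsum_mul_tsum_of_summable_norm hθ hv1, ← e1.tsum_eq]
    refine tsum_congr fun t => ?_
    simp only [e1, Equiv.coe_fn_mk]
    rw [show x ^ t.1 = x ^ (t.1 - 3 * t.2) * x ^ (3 * t.2) by rw [← zpow_add₀ hx]; simp]
    ring
  have t2 : jt p x * ∑' n, v n * x ^ (-3 * n - 1) =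
      ∑' N : ℤ, ∑' n : ℤ, x ^ N * (theta p (N + 3 * n + 1) * v n) := by
    rw [← s2.tsum_prod, jt, tsum_mul_tsum_of_summable_norm hθ hv2, ← e2.tsum_eq]
    refine tsum_congr fun t => ?_
    simp only [e2, Equiv.coe_fn_mk]
    rw [show x ^ t.1 = x ^ (t.1 + 3 * t.2 + 1) * x ^ (-3 * t.2 - 1) by
      rw [← zpow_add₀ hx]; congr 1; ring]
    ring
  have t3 : quintSeries p x = ∑' n, v n * x ^ (3 * n) + ∑' n, v n * x ^ (-3 * n - 1) := by
    rw [← hv1.of_norm.tsum_add hv2.of_norm]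
    exact tsum_congr fun n => by simp only [hv]; ring
  rw [t3, mul_add, t1, t2, ← s1.prod.tsum_add s2.prod,
    tsum_int_parity (s1.prod.add s2.prod)]
  have A1 : ∀ N n : ℤ, theta p (N - 3 * n) * v n =
      (-1) ^ N * p ^ (6 * (n * n) + 2 * n - 3 * (n * N) + tri (N - 1)) := by
    intro N n
    simp only [theta, hv]
    have g1 : (-1 : ℂ) ^ N = (-1) ^ (N - 3 * n) * (-1) ^ n := by
      rw [← zpow_add₀ (by norm_num)]
      exact neg_one_zpow_eq_of_even ⟨n, by ring⟩
    have g2 : 6 * (n * n) + 2 * n - 3 * (n * N) + tri (N - 1) =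
        tri (N - 3 * n - 1) + (3 * tri n - n) := by
      have h1 := two_mul_tri (N - 1)
      have h2 := two_mul_tri (N - 3 * n - 1)
      have h3 := two_mul_tri n
      apply mul_left_cancel₀ (two_ne_zero : (2 : ℤ) ≠ 0)
      linear_combination h1 - h2 - 3 * h3
    rw [g1, g2, zpow_add₀ hp0]
    ring
  have A2 : ∀ N n : ℤ, theta p (N + 3 * n + 1) * v n =
      -((-1) ^ N * p ^ (6 * (n * n) + 2 * n + 3 * (n * N) + tri N)) := by
    intro N n
    simp only [theta, hv]
    have g1 : (-1 : ℂ) ^ N = -((-1) ^ (N + 3 * n + 1) * (-1) ^ n) := by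
      rw [← zpow_add₀ (by norm_num)]
      exact neg_one_zpow_eq_neg ⟨-2 * n - 1, by ring⟩
    have g2 : 6 * (n * n) + 2 * n + 3 * (n * N) + tri N =
        tri (N + 3 * n + 1 - 1) + (3 * tri n - n) := by
      have h1 := two_mul_tri N
      have h2 := two_mul_tri (N + 3 * n + 1 - 1)
      have h3 := two_mul_tri n
      apply mul_left_cancel₀ (two_ne_zero : (2 : ℤ) ≠ 0)
      linear_combination h1 - h2 - 3 * h3
    rw [g1, g2, zpow_add₀ hp0]
    ring
  have even : ∀ M : ℤ, ∑' n : ℤ, x ^ (2 * M) * (theta p (2 * M - 3 * n) * v n) +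
      ∑' n : ℤ, x ^ (2 * M) * (theta p (2 * M + 3 * n + 1) * v n) = 0 := by
    intro M
    rw [← (Equiv.subRight M).tsum_eq fun n => x ^ (2 * M) * (theta p (2 * M + 3 * n + 1) * v n),
      ← eq_neg_iff_add_eq_zero, ← tsum_neg]
    refine tsum_congr fun n => ?_
    simp only [Equiv.subRight_apply]
    rw [A1, A2]
    have g : 6 * (n * n) + 2 * n - 3 * (n * (2 * M)) + tri (2 * M - 1) =
        6 * ((n - M) * (n - M)) + 2 * (n - M) + 3 * ((n - M) * (2 * M)) + tri (2 * M) := by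
      have h1 := two_mul_tri (2 * M - 1)
      have h2 := two_mul_tri (2 * M)
      apply mul_left_cancel₀ (two_ne_zero : (2 : ℤ) ≠ 0)
      linear_combination h1 - h2
    rw [g]
    ring
  have odd : ∀ M : ℤ, ∑' n : ℤ, x ^ (2 * M - 1) * (theta p (2 * M - 1 - 3 * n) * v n) +
      ∑' n : ℤ, x ^ (2 * M - 1) * (theta p (2 * M - 1 + 3 * n + 1) * v n) =
      x⁻¹ * pentSeries p * (theta p M * (x ^ 2) ^ M) := by
    intro M
    have hb : Function.Bijective (Sum.elim (fun n : ℤ => M - 1 - 2 * n) fun n => -(2 * n + M)) := by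
      constructor
      · rintro (a | a) (b | b) h <;> simp at h ⊢ <;> omega
      · intro n
        rcases Int.even_or_odd' (n + M) with ⟨k, hk | hk⟩
        · exact ⟨Sum.inr (-k), by simp; omega⟩
        · exact ⟨Sum.inl (M - 1 - k), by simp; omega⟩
    rw [pentSeries, tsum_eq_add_of_bijective (summable_pent_one hp0 hp).of_norm hb, mul_add, add_mul,
      ← tsum_mul_left, ← tsum_mul_right, ← tsum_mul_left, ← tsum_mul_right]
    have hxM : x ^ (2 * M - 1) = x⁻¹ * (x ^ 2) ^ M := by
      rw [zpow_sub_one₀ hx, zpow_mul, mul_comm]; norm_cast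
    congr 1
    · refine tsum_congr fun n => ?_
      rw [A1, hxM]
      unfold theta
      have g1 : (-1 : ℂ) ^ (2 * M - 1) = (-1) ^ (M - 1 - 2 * n) * (-1) ^ M := by
        rw [← zpow_add₀ (by norm_num)]
        exact neg_one_zpow_eq_of_even ⟨n, by ring⟩
      have g2 : 6 * (n * n) + 2 * n - 3 * (n * (2 * M - 1)) + tri (2 * M - 1 - 1) =
          3 * tri (M - 1 - 2 * n) - (M - 1 - 2 * n) + tri (M - 1) := by
        have h1 := two_mul_tri (2 * M - 1 - 1)
        have h2 := two_mul_tri (M - 1 - 2 * n)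
        have h3 := two_mul_tri (M - 1)
        apply mul_left_cancel₀ (two_ne_zero : (2 : ℤ) ≠ 0)
        linear_combination h1 - 3 * h2 - h3
      rw [g1, g2, zpow_add₀ hp0]
      ring
    · refine tsum_congr fun n => ?_
      rw [A2, hxM]
      unfold theta
      have g1 : (-1 : ℂ) ^ (2 * M - 1) = -((-1) ^ (-(2 * n + M)) * (-1) ^ M) := by
        rw [← zpow_add₀ (by norm_num)]
        exact neg_one_zpow_eq_neg ⟨n + M - 1, by ring⟩
      have g2 : 6 * (n * n) + 2 * n + 3 * (n * (2 * M - 1)) + tri (2 * M - 1) =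
          3 * tri (-(2 * n + M)) - (-(2 * n + M)) + tri (M - 1) := by
        have h1 := two_mul_tri (2 * M - 1)
        have h2 := two_mul_tri (-(2 * n + M))
        have h3 := two_mul_tri (M - 1)
        apply mul_left_cancel₀ (two_ne_zero : (2 : ℤ) ≠ 0)
        linear_combination h1 - 3 * h2 - h3
      rw [g1, g2, zpow_add₀ hp0]
      ring
  simp_rw [even, odd]
  rw [tsum_zero, zero_add, tsum_mul_left]
  rfl

/-- The shape of the three-term partial fraction expansion used for Lambert series. -/
theorem pfA_mul_pfA_mul_pfA_div {p z ζ : ℂ} (hp0 : p ≠ 0) (hp : ‖p‖ < 1) (hJ : thetaConst p ≠ 0)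
    (hz : Generic p z) (hzm : Generic p (z * ζ)) (hzd : Generic p (z / ζ)) (h1 : Generic p ζ)
    (h2 : Generic p (ζ ^ 2)) :
    pfA p z * pfA p (z * ζ) * pfA p (z / ζ) = -ζ * pfA p ζ ^ 2 * appell p z 1 +
      pfA p ζ * pfA p (ζ ^ 2) *
        (ζ ^ 3 * appell p (z * ζ) (ζ ^ 3) + appell p (z / ζ) (ζ ^ 3)⁻¹) := by
  have hz0 := hz.1
  have hζ := h1.1
  have e1 : z * ζ / z = ζ := by field_simp
  have e2 : z / ζ / z = ζ⁻¹ := by field_simp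
  have e3 : z / ζ / (z * ζ) = (ζ ^ 2)⁻¹ := by field_simp
  have e4 : z / (z * ζ) = ζ⁻¹ := by field_simp
  have e5 : z / (z / ζ) = ζ := by field_simp
  have e6 : z * ζ / (z / ζ) = ζ ^ 2 := by field_simp
  have e7 : z ^ 2 / (z * ζ * (z / ζ)) = 1 := by field_simp
  have e8 : (z * ζ) ^ 2 / (z * (z / ζ)) = ζ ^ 3 := by field_simp
  have e9 : (z / ζ) ^ 2 / (z * (z * ζ)) = (ζ ^ 3)⁻¹ := by field_simp
  have h := pfA_mul_pfA_mul_pfA hp0 hp hJ hz hzm hzd (by rwa [e1]) (by rw [e2]; exact h1.inv)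
    (by rw [e3]; exact h2.inv)
  rw [e1, e2, e3, e4, e5, e6, e7, e8, e9, h1.pfA_inv hp0 hp hJ, h2.pfA_inv hp0 hp hJ] at h
  rw [h]
  ring

lemma tsum_int_five {f : ℤ → ℂ} (hf : Summable f) (c : ℤ) :
    ∑' n, f n = ∑' m : ℤ, f (5 * m + c) + ∑' m : ℤ, f (5 * m + (c + 1)) +
      ∑' m : ℤ, f (5 * m + (c + 2)) + ∑' m : ℤ, f (5 * m + (c + 3)) +
      ∑' m : ℤ, f (5 * m + (c + 4)) := by
  let e : Fin 5 × ℤ ≃ ℤ := ((Equiv.prodComm _ _).trans (Int.divModEquiv 5).symm).trans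
    (Equiv.addRight c)
  have hs : Summable fun t => f (e t) := e.summable_iff.2 hf
  rw [← e.tsum_eq f, hs.tsum_prod, tsum_fintype, Fin.sum_univ_five]
  have h : ∀ (r : Fin 5) (m : ℤ), e (r, m) = 5 * m + (c + (r : ℕ)) := by
    intro r m
    simp [e, Int.divModEquiv]
    ring
  simp [h]

lemma tsum_int_ne_zero {f : ℤ → ℂ} {r : ℝ} (h0 : f 0 = 1) (hr0 : 0 ≤ r) (hr : r < 1 / 16)
    (hf : ∀ n : ℤ, n ≠ 0 → ‖f n‖ ≤ r ^ n.natAbs) : ∑' n, f n ≠ 0 := by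
  intro hsum
  have g1 : HasSum (fun n : ℕ => r ^ (n : ℤ).natAbs) (1 - r)⁻¹ := by
    simpa using hasSum_geometric_of_lt_one hr0 (by linarith)
  have g2 : HasSum (fun n : ℕ => r ^ (-((n : ℤ) + 1)).natAbs) (r * (1 - r)⁻¹) := by
    refine ((hasSum_geometric_of_lt_one hr0 (by linarith)).mul_left r).congr_fun fun n => ?_
    rw [show (-((n : ℤ) + 1)).natAbs = n + 1 by omega]
    ring
  have g := HasSum.of_nat_of_neg_add_one (f := fun n : ℤ => r ^ n.natAbs) g1 g2
  have hS : Summable f := Summable.of_norm_bounded g.summable fun n => by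
    by_cases hn : n = 0
    · simp [hn, h0]
    · exact hf n hn
  have k := hS.hasSum.sub (hasSum_ite_eq (0 : ℤ) (1 : ℂ))
  have kr := g.sub (hasSum_ite_eq (0 : ℤ) (1 : ℝ))
  have hb : ∀ n : ℤ, ‖f n - if n = 0 then 1 else 0‖ ≤ r ^ n.natAbs - if n = 0 then 1 else 0 := by
    intro n
    by_cases hn : n = 0
    · simp [hn, h0]
    · simpa [hn] using hf n hn
  have := tsum_of_norm_bounded kr hb
  rw [k.tsum_eq, hsum] at this
  have h1 : (1 - r)⁻¹ + r * (1 - r)⁻¹ < 2 := by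
    rw [← one_add_mul, ← div_eq_mul_inv, div_lt_iff₀ (by linarith)]
    linarith
  simp at this
  linarith

lemma zpow_le_pow_natAbs {r : ℝ} (hr0 : 0 < r) (hr : r ≤ 1) {k n : ℤ} (h : |n| ≤ k) :
    r ^ k ≤ r ^ n.natAbs := by
  rw [← zpow_natCast, ← Int.abs_eq_natAbs]
  exact zpow_le_zpow_right_of_le_one₀ hr0 hr h

lemma tri_nonneg (n : ℤ) : 0 ≤ tri n := by
  have h := two_mul_tri n
  have : 0 ≤ n * (n + 1) := by
    rcases le_or_gt 0 n with h | h
    · positivity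
    · exact mul_nonneg_of_nonpos_of_nonpos h.le (by linarith)
  linarith

lemma self_le_tri (n : ℤ) : n ≤ tri n := by
  have h := two_mul_tri n
  have : 0 ≤ n * (n - 1) := by
    rcases le_or_gt n 0 with h | h
    · exact mul_nonneg_of_nonpos_of_nonpos h (by linarith)
    · exact mul_nonneg h.le (by linarith)
  linarith

lemma norm_one_sub_inv_le {w : ℂ} (h : ‖w‖ ≤ 1 / 16) : ‖(1 - w)⁻¹‖ ≤ 16 / 15 := by
  have h1 : 15 / 16 ≤ ‖1 - w‖ := by
    have := norm_sub_norm_le 1 w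
    rw [norm_one] at this
    linarith
  rw [norm_inv]
  exact (inv_anti₀ (by norm_num) h1).trans (by norm_num)

lemma pentSeries_ne_zero {p : ℂ} (hp0 : p ≠ 0) (hp : ‖p‖ < 1 / 16) : pentSeries p ≠ 0 := by
  refine tsum_int_ne_zero (by simp [tri_zero]) (norm_nonneg p) hp fun n hn => ?_
  simp only [norm_mul, norm_zpow, norm_neg, norm_one, one_zpow, one_mul]
  refine zpow_le_pow_natAbs (norm_pos_iff.2 hp0) (by linarith) ?_
  have h1 := tri_nonneg n
  have h2 := self_le_tri n
  rcases abs_cases n with ⟨h, -⟩ | ⟨h, -⟩ <;> rw [h] <;> linarith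

lemma norm_pow_lt_one {q : ℂ} (hq : ‖q‖ < 1 / 16) {n : ℕ} (hn : n ≠ 0) : ‖q ^ n‖ < 1 / 16 := by
  rw [norm_pow]
  exact (pow_le_of_le_one (norm_nonneg _) (by linarith) hn).trans_lt hq

lemma generic_pow {q : ℂ} (hq0 : q ≠ 0) (hq : ‖q‖ < 1 / 16) {k : ℤ} (hk : ¬ (5 : ℤ) ∣ k) :
    Generic (q ^ 5) (q ^ k) := by
  refine ⟨zpow_ne_zero _ hq0, fun m => ?_⟩
  rw [show (q ^ 5) ^ m = q ^ (5 * m) by rw [zpow_mul]; rfl, ← zpow_add₀ hq0]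
  exact zpow_ne_one_of_ne (by linarith) (by omega)

lemma jt_pow_ne_zero {q : ℂ} (hq0 : q ≠ 0) (hq : ‖q‖ < 1 / 16) : jt (q ^ 5) q ≠ 0 := by
  refine tsum_int_ne_zero (by simp [theta_zero]) (norm_nonneg q) hq fun n hn => ?_
  rw [show theta (q ^ 5) n * q ^ n = (-1) ^ n * q ^ (5 * tri (n - 1) + n) by
    rw [zpow_add₀ hq0, zpow_mul, theta, mul_assoc]; rfl]
  simp only [norm_mul, norm_zpow, norm_neg, norm_one, one_zpow, one_mul]
  refine zpow_le_pow_natAbs (norm_pos_iff.2 hq0) (by linarith) ?_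
  have h1 := tri_nonneg (n - 1)
  have h2 := two_mul_tri (n - 1)
  rcases abs_cases n with ⟨h, -⟩ | ⟨h, -⟩ <;> rw [h] <;> nlinarith

lemma pfA_pow_ne_zero {q : ℂ} (hq0 : q ≠ 0) (hq : ‖q‖ < 1 / 16) : pfA (q ^ 5) q ≠ 0 := by
  have hr0 : 0 < ‖q‖ := norm_pos_iff.2 hq0
  have h1q : 1 - q ≠ 0 := by
    intro h
    rw [← sub_eq_zero.1 h, norm_one] at hq
    norm_num at hq
  have hle : ‖1 - q‖ ≤ 17 / 16 := (norm_sub_le 1 q).trans (by rw [norm_one]; linarith)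
  refine right_ne_zero_of_mul (a := 1 - q) ?_
  rw [pfA, ← tsum_mul_left]
  refine tsum_int_ne_zero (by simp [tri_zero, h1q]) hr0.le hq fun n hn => ?_
  have key : ∀ k : ℤ, |n| + 1 ≤ k → ∀ C : ℝ, C ≤ 16 / 15 * ‖q‖ ^ k → 
      ‖1 - q‖ * C ≤ ‖q‖ ^ n.natAbs := by
    intro k hk C hC
    have h1 : ‖q‖ ^ (k - 1) ≤ ‖q‖ ^ n.natAbs := zpow_le_pow_natAbs hr0 (by linarith) (by linarith)
    have h2 : ‖q‖ ^ k = ‖q‖ ^ (k - 1) * ‖q‖ := by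
      rw [← zpow_add_one₀ hr0.ne', sub_add_cancel]
    have h3 : 0 < ‖q‖ ^ (k - 1) := zpow_pos hr0 _
    calc ‖1 - q‖ * C ≤ ‖1 - q‖ * (16 / 15 * ‖q‖ ^ k) := by gcongr
      _ ≤ 17 / 16 * (16 / 15 * ‖q‖ ^ k) := by gcongr
      _ ≤ ‖q‖ ^ (k - 1) := by rw [h2]; nlinarith
      _ ≤ _ := h1
  have hpow : ∀ m : ℤ, (q ^ 5) ^ m = q ^ (5 * m) := fun m => by rw [zpow_mul]; rfl
  rw [norm_mul, norm_mul, norm_mul, norm_zpow, norm_neg, norm_one, one_zpow, one_mul, hpow, hpow,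
    norm_zpow]
  have ht := tri_nonneg n
  have ht1 := self_le_tri n
  have hw : q * q ^ (5 * n) = q ^ (5 * n + 1) := by rw [zpow_add_one₀ hq0, mul_comm]
  have small : ∀ k : ℤ, 1 ≤ k → ‖q ^ k‖ ≤ 1 / 16 := fun k hk => by
    rw [norm_zpow]
    exact (zpow_le_zpow_right_of_le_one₀ hr0 (by linarith) hk).trans (by rw [zpow_one]; exact hq.le)
  rcases lt_or_gt_of_ne hn with h | h
  · refine key (5 * tri n + (-(5 * n + 1))) (by rw [abs_of_neg h]; linarith) _ ?_
    have e : (1 - q * q ^ (5 * n))⁻¹ = -(q ^ (-(5 * n + 1)) * (1 - q ^ (-(5 * n + 1)))⁻¹) := by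
      rw [hw, zpow_neg]
      have h0 : q ^ (5 * n + 1) ≠ 0 := zpow_ne_zero _ hq0
      have h2 : q ^ (5 * n + 1) ≠ 1 := zpow_ne_one_of_ne (by linarith) (by omega)
      generalize q ^ (5 * n + 1) = w at *
      have h3 : 1 - w ≠ 0 := sub_ne_zero.2 h2.symm
      have h4 : w - 1 ≠ 0 := sub_ne_zero.2 h2
      field_simp
      ring
    rw [e, norm_neg, norm_mul, zpow_add₀ hr0.ne', ← norm_zpow q (-(5 * n + 1))]
    have := norm_one_sub_inv_le (small (-(5 * n + 1)) (by linarith))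
    calc _ ≤ ‖q‖ ^ (5 * tri n) * (‖q ^ (-(5 * n + 1))‖ * (16 / 15)) := by gcongr
      _ = _ := by ring
  · refine key (5 * tri n) (by rw [abs_of_pos h]; linarith) _ ?_
    rw [hw, mul_comm (16 / 15)]
    gcongr
    exact norm_one_sub_inv_le (small _ (by linarith))

lemma thetaConst_ne_zero {q : ℂ} (hq0 : q ≠ 0) (hq : ‖q‖ < 1 / 16) :
    thetaConst (q ^ 5) ≠ 0 := by
  rw [← Generic.jt_mul_pfA (pow_ne_zero 5 hq0)
    ((norm_pow_lt_one hq (by norm_num)).trans (by norm_num))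
    (by simpa using generic_pow hq0 hq (k := 1) (by norm_num))]
  exact mul_ne_zero (jt_pow_ne_zero hq0 hq) (pfA_pow_ne_zero hq0 hq)

lemma jt_reflect {p x : ℂ} (hp0 : p ≠ 0) (hx : x ≠ 0) : jt p (p / x) = jt p x := by
  rw [div_eq_mul_inv, jt_mul hp0 (inv_ne_zero hx), jt_inv hx]
  field_simp

lemma thetaLog_reflect {p x : ℂ} (hp0 : p ≠ 0) (hp : ‖p‖ < 1) (hx : x ≠ 0) (hj : jt p x ≠ 0) :
    thetaLog p (p / x) = -thetaLog p x := by
  have hj' : jt p x⁻¹ ≠ 0 := by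
    rw [jt_inv hx]
    exact neg_ne_zero.2 (mul_ne_zero (inv_ne_zero hx) hj)
  rw [div_eq_mul_inv, thetaLog_mul hp0 hp (inv_ne_zero hx) hj', thetaLog_inv hp0 hp hx hj]
  ring

/-- A quotient of theta functions, equal to the inverse of the Rogers–Ramanujan quotient without
its fractional power of `q`. -/
noncomputable def jtRatio (q : ℂ) : ℂ := jt (q ^ 5) (q ^ 2) / jt (q ^ 5) q

section Modulus

variable {q : ℂ} (hq0 : q ≠ 0) (hq : ‖q‖ < 1 / 16)

include hq in
lemma norm_pow_five_lt_one : ‖q ^ 5‖ < 1 :=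
  (norm_pow_lt_one hq (by norm_num)).trans (by norm_num)

include hq0 hq

lemma generic_one : Generic (q ^ 5) q := by
  simpa using generic_pow hq0 hq (k := 1) (by norm_num)

lemma generic_npow {k : ℕ} (hk : ¬ 5 ∣ k) : Generic (q ^ 5) (q ^ k) := by
  simpa using generic_pow hq0 hq (k := k) (by exact_mod_cast hk)

lemma jt_pow_ne_zero_of_not_dvd {k : ℕ} (hk : ¬ 5 ∣ k) : jt (q ^ 5) (q ^ k) ≠ 0 :=
  (generic_npow hq0 hq hk).jt_ne_zero (pow_ne_zero 5 hq0) (norm_pow_five_lt_one hq)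
    (thetaConst_ne_zero hq0 hq)

lemma jtRatio_ne_zero : jtRatio q ≠ 0 :=
  div_ne_zero (jt_pow_ne_zero_of_not_dvd hq0 hq (by norm_num)) (jt_pow_ne_zero hq0 hq)

omit hq in
lemma jt_pow_three : jt (q ^ 5) (q ^ 3) = jt (q ^ 5) (q ^ 2) := by
  rw [← jt_reflect (pow_ne_zero 5 hq0) (pow_ne_zero 2 hq0)]
  congr 1
  field_simp

omit hq in
lemma jt_pow_four : jt (q ^ 5) (q ^ 4) = jt (q ^ 5) q := by
  rw [← jt_reflect (pow_ne_zero 5 hq0) hq0]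
  congr 1
  field_simp

lemma pfA_pow_eq {k : ℕ} (hk : ¬ 5 ∣ k) :
    pfA (q ^ 5) (q ^ k) = thetaConst (q ^ 5) / jt (q ^ 5) (q ^ k) :=
  (generic_npow hq0 hq hk).pfA_eq (pow_ne_zero 5 hq0) (norm_pow_five_lt_one hq)
    (thetaConst_ne_zero hq0 hq)

lemma pfA_self_eq : pfA (q ^ 5) q = thetaConst (q ^ 5) / jt (q ^ 5) q := by
  simpa using pfA_pow_eq hq0 hq (k := 1) (by norm_num)

lemma pfA_pow_three : pfA (q ^ 5) (q ^ 3) = pfA (q ^ 5) (q ^ 2) := by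
  rw [pfA_pow_eq hq0 hq (by norm_num), pfA_pow_eq hq0 hq (by norm_num), jt_pow_three hq0]

lemma pfA_pow_four : pfA (q ^ 5) (q ^ 4) = pfA (q ^ 5) q := by
  rw [pfA_pow_eq hq0 hq (by norm_num), pfA_self_eq hq0 hq, jt_pow_four hq0]

lemma pfA_pow_two_ne_zero : pfA (q ^ 5) (q ^ 2) ≠ 0 :=
  (generic_npow hq0 hq (by norm_num)).pfA_ne_zero (pow_ne_zero 5 hq0) (norm_pow_five_lt_one hq)
    (thetaConst_ne_zero hq0 hq)

lemma pfA_self : pfA (q ^ 5) q = jtRatio q * pfA (q ^ 5) (q ^ 2) := by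
  rw [pfA_pow_eq hq0 hq (by norm_num), pfA_self_eq hq0 hq, jtRatio]
  have := jt_pow_ne_zero_of_not_dvd hq0 hq (k := 2) (by norm_num)
  field_simp

lemma thetaLog_pow_three : thetaLog (q ^ 5) (q ^ 3) = -thetaLog (q ^ 5) (q ^ 2) := by
  rw [← thetaLog_reflect (pow_ne_zero 5 hq0) (norm_pow_five_lt_one hq) (pow_ne_zero 2 hq0)
    (jt_pow_ne_zero_of_not_dvd hq0 hq (by norm_num))]
  congr 1
  field_simp

lemma thetaLog_pow_four : thetaLog (q ^ 5) (q ^ 4) = -thetaLog (q ^ 5) q := by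
  rw [← thetaLog_reflect (pow_ne_zero 5 hq0) (norm_pow_five_lt_one hq) hq0 (jt_pow_ne_zero hq0 hq)]
  congr 1
  field_simp

lemma thetaLog_relation_one : 3 * thetaLog (q ^ 5) q + thetaLog (q ^ 5) (q ^ 2) - 1 =
    -(pfA (q ^ 5) q * jtRatio q ^ 2) := by
  have hp0 := pow_ne_zero 5 hq0
  have hp := norm_pow_five_lt_one hq
  have j1 := jt_pow_ne_zero hq0 hq
  have j2 := jt_pow_ne_zero_of_not_dvd hq0 hq (k := 2) (by norm_num)
  have e1 : q * q ^ 2 = q ^ 3 := by ring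
  have e2 : q / q ^ 2 = q⁻¹ := by field_simp
  have ji : jt (q ^ 5) q⁻¹ ≠ 0 := by
    rw [jt_inv hq0]; exact neg_ne_zero.2 (mul_ne_zero (inv_ne_zero hq0) j1)
  have h := thetaLog_add_sub (y := 1) (u := q) (v := q ^ 2) hp0 hp one_ne_zero hq0
    (pow_ne_zero 2 hq0) (by rwa [mul_one]) (by rwa [div_one]) (by rwa [e1, jt_pow_three hq0])
    (by rwa [e2])
  rw [e1, e2, mul_one, div_one, one_mul, one_div, thetaLog_pow_three hq0 hq,
    thetaLog_inv hp0 hp hq0 j1, jt_pow_three hq0, jt_inv hq0, jt_inv (pow_ne_zero 2 hq0)] at h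
  rw [pfA_self_eq hq0 hq, jtRatio]
  generalize jt (q ^ 5) q = a, jt (q ^ 5) (q ^ 2) = b at *
  field_simp at h ⊢
  linear_combination (-1) * h

lemma thetaLog_relation_two : 3 * thetaLog (q ^ 5) (q ^ 2) - thetaLog (q ^ 5) q =
    q * pfA (q ^ 5) (q ^ 2) / jtRatio q ^ 2 := by
  have hp0 := pow_ne_zero 5 hq0
  have hp := norm_pow_five_lt_one hq
  have j1 := jt_pow_ne_zero hq0 hq
  have j2 := jt_pow_ne_zero_of_not_dvd hq0 hq (k := 2) (by norm_num)
  have e1 : q ^ 2 * q ^ 4 = q ^ 5 * q := by ring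
  have e2 : q ^ 2 / q ^ 4 = (q ^ 2)⁻¹ := by field_simp
  have e3 : (q ^ 2) ^ 2 = q ^ 4 := by ring
  have ji : jt (q ^ 5) (q ^ 2)⁻¹ ≠ 0 := by
    rw [jt_inv (pow_ne_zero 2 hq0)]
    exact neg_ne_zero.2 (mul_ne_zero (inv_ne_zero (pow_ne_zero 2 hq0)) j2)
  have jm : jt (q ^ 5) (q ^ 5 * q) ≠ 0 := by
    rw [jt_mul hp0 hq0]; exact neg_ne_zero.2 (mul_ne_zero (inv_ne_zero hq0) j1)
  have h := thetaLog_add_sub (y := 1) (u := q ^ 2) (v := q ^ 4) hp0 hp one_ne_zero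
    (pow_ne_zero 2 hq0) (pow_ne_zero 4 hq0) (by rwa [mul_one]) (by rwa [div_one]) (by rwa [e1])
    (by rwa [e2])
  rw [e1, e2, e3, mul_one, div_one, one_mul, one_div, thetaLog_inv hp0 hp (pow_ne_zero 2 hq0) j2,
    thetaLog_mul hp0 hp hq0 j1, jt_mul hp0 hq0, jt_inv (pow_ne_zero 2 hq0),
    jt_inv (pow_ne_zero 4 hq0), jt_pow_four hq0] at h
  rw [pfA_pow_eq hq0 hq (by norm_num), jtRatio]
  generalize jt (q ^ 5) q = a, jt (q ^ 5) (q ^ 2) = b at *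
  field_simp at h ⊢
  linear_combination h

lemma quintSeries_inv : quintSeries (q ^ 5) q⁻¹ = pentSeries (q ^ 5) * jtRatio q := by
  have j1 := jt_pow_ne_zero hq0 hq
  have h := jt_mul_quintSeries (pow_ne_zero 5 hq0) (norm_pow_five_lt_one hq) (inv_ne_zero hq0)
  rw [inv_inv, inv_pow, jt_inv hq0, jt_inv (pow_ne_zero 2 hq0)] at h
  rw [jtRatio]
  field_simp at h ⊢
  linear_combination (-1) * h

lemma quintSeries_inv_sq : quintSeries (q ^ 5) (q ^ 2)⁻¹ = pentSeries (q ^ 5) / jtRatio q := by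
  have j1 := jt_pow_ne_zero hq0 hq
  have j2 := jt_pow_ne_zero_of_not_dvd hq0 hq (k := 2) (by norm_num)
  have h := jt_mul_quintSeries (pow_ne_zero 5 hq0) (norm_pow_five_lt_one hq)
    (inv_ne_zero (pow_ne_zero 2 hq0))
  rw [inv_inv, inv_pow, jt_inv (pow_ne_zero 2 hq0), ← pow_mul, jt_inv (pow_ne_zero _ hq0),
    jt_pow_four hq0] at h
  rw [jtRatio]
  generalize quintSeries (q ^ 5) (q ^ 2)⁻¹ = V at *
  field_simp at h ⊢
  refine mul_left_cancel₀ (pow_ne_zero 4 hq0) ?_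
  linear_combination (-1) * h

lemma appell_pair_one : q ^ 3 * appell (q ^ 5) (q ^ 3) (q ^ 3) + appell (q ^ 5) q (q ^ 3)⁻¹ =
    q * jtRatio q * appell (q ^ 5) (q ^ 2) 1 + pfA (q ^ 5) (q ^ 2) := by
  have e1 : q ^ 2 * q = q ^ 3 := by ring
  have e2 : q ^ 2 / q = q := by field_simp
  have g1 := generic_one hq0 hq
  have g2 := generic_npow hq0 hq (k := 2) (by norm_num)
  have h := pfA_mul_pfA_mul_pfA_div (pow_ne_zero 5 hq0) (norm_pow_five_lt_one hq)
    (thetaConst_ne_zero hq0 hq) g2 (by rw [e1]; exact generic_npow hq0 hq (by norm_num))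
    (by rwa [e2]) g1 g2
  rw [e1, e2, pfA_pow_three hq0 hq, pfA_self hq0 hq] at h
  have A2 := pfA_pow_two_ne_zero hq0 hq
  have ha := jtRatio_ne_zero hq0 hq
  refine mul_left_cancel₀ (mul_ne_zero ha (pow_ne_zero 2 A2)) ?_
  linear_combination (-1) * h

lemma appell_pair_two :
    q ^ 6 * appell (q ^ 5) (q ^ 4) (q ^ 6) + appell (q ^ 5) 1 (q ^ 6)⁻¹ =
    q ^ 2 / jtRatio q * appell (q ^ 5) (q ^ 2) 1 +
      (thetaLog (q ^ 5) (q ^ 2) - thetaLog (q ^ 5) q) := by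
  have e1 : (q ^ 2) ^ 3 = q ^ 6 := by ring
  have e2 : (q ^ 2) ^ 2 = q ^ 4 := by ring
  have h := appell_one (ζ := q ^ 2) (pow_ne_zero 5 hq0) (norm_pow_five_lt_one hq)
    (thetaConst_ne_zero hq0 hq) (generic_npow hq0 hq (by norm_num))
    (by rw [e2]; exact generic_npow hq0 hq (by norm_num))
  rw [e1, e2, pfA_pow_four hq0 hq, thetaLog_pow_four hq0 hq, pfA_self hq0 hq] at h
  rw [h]
  have A2 := pfA_pow_two_ne_zero hq0 hq
  field_simp
  ring

lemma appell_pair_three :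
    q ^ 3 * appell (q ^ 5) (q ^ 2) (q ^ 3) + appell (q ^ 5) 1 (q ^ 3)⁻¹ =
    q * jtRatio q * appell (q ^ 5) q 1 + (thetaLog (q ^ 5) q + thetaLog (q ^ 5) (q ^ 2)) := by
  have h := appell_one (pow_ne_zero 5 hq0) (norm_pow_five_lt_one hq)
    (thetaConst_ne_zero hq0 hq) (generic_one hq0 hq) (generic_npow hq0 hq (k := 2) (by norm_num))
  rw [pfA_self hq0 hq] at h
  rw [h]
  have A2 := pfA_pow_two_ne_zero hq0 hq
  field_simp

lemma appell_pair_four :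
    q ^ 6 * appell (q ^ 5) (q ^ 3) (q ^ 6) + appell (q ^ 5) q⁻¹ (q ^ 6)⁻¹ =
    q ^ 2 / jtRatio q * appell (q ^ 5) q 1 - q * pfA (q ^ 5) q := by
  have e1 : q * q ^ 2 = q ^ 3 := by ring
  have e2 : q / q ^ 2 = q⁻¹ := by field_simp
  have e3 : (q ^ 2) ^ 3 = q ^ 6 := by ring
  have e4 : (q ^ 2) ^ 2 = q ^ 4 := by ring
  have g1 := generic_one hq0 hq
  have h := pfA_mul_pfA_mul_pfA_div (pow_ne_zero 5 hq0) (norm_pow_five_lt_one hq)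
    (thetaConst_ne_zero hq0 hq) g1 (by rw [e1]; exact generic_npow hq0 hq (by norm_num))
    (by rw [e2]; exact g1.inv) (generic_npow hq0 hq (k := 2) (by norm_num))
    (by rw [e4]; exact generic_npow hq0 hq (by norm_num))
  rw [e1, e2, e3, e4, g1.pfA_inv (pow_ne_zero 5 hq0) (norm_pow_five_lt_one hq)
    (thetaConst_ne_zero hq0 hq), pfA_pow_three hq0 hq, pfA_pow_four hq0 hq, pfA_self hq0 hq] at h
  have A2 := pfA_pow_two_ne_zero hq0 hq
  have ha := jtRatio_ne_zero hq0 hq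
  rw [pfA_self hq0 hq]
  generalize appell (q ^ 5) q⁻¹ (q ^ 6)⁻¹ = L at *
  field_simp
  refine mul_left_cancel₀ (pow_ne_zero 2 A2) ?_
  linear_combination (-1) * h

end Modulus

/-- The Lambert-type series appearing in the generating functions of ranks modulo five. At `n = 0`
the summand is zero, as `0⁻¹ = 0`. -/
noncomputable def lambert (q : ℂ) (b : ℤ) : ℂ :=
  ∑' n : ℤ, (-1) ^ n * q ^ (3 * tri n + b * n) * (1 - q ^ (5 * n))⁻¹

lemma summable_lambert {q : ℂ} (hq0 : q ≠ 0) (hq : ‖q‖ < 1) (b : ℤ) :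
    Summable fun n : ℤ => ‖(-1) ^ n * q ^ (3 * tri n + b * n) * (1 - q ^ (5 * n))⁻¹‖ := by
  obtain ⟨C, -, hC⟩ := exists_inv_bound (pow_ne_zero 5 hq0)
    (by rw [norm_pow]; exact pow_lt_one₀ (norm_nonneg _) hq (by norm_num)) 1
  refine Summable.of_nonneg_of_le (fun n => norm_nonneg _) (fun n => ?_)
    ((summable_appell_coeff hq0 hq (zpow_ne_zero b hq0)).mul_right C)
  rw [norm_mul, zpow_add₀ hq0, zpow_mul q b, ← mul_assoc, zpow_mul q 5]
  refine mul_le_mul_of_nonneg_left ?_ (norm_nonneg _)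
  simpa using hC n

lemma three_mul_tri_five_mul_add (m r : ℤ) :
    3 * tri (5 * m + r) = 75 * tri m + (15 * r - 30) * m + 3 * tri r := by
  have h1 := two_mul_tri (5 * m + r)
  have h2 := two_mul_tri m
  have h3 := two_mul_tri r
  apply mul_left_cancel₀ (two_ne_zero : (2 : ℤ) ≠ 0)
  linear_combination 3 * h1 - 75 * h2 - 3 * h3

lemma neg_one_zpow_five_mul_add (m r : ℤ) : (-1 : ℂ) ^ (5 * m + r) = (-1) ^ r * (-1) ^ m := by
  rw [← zpow_add₀ (by norm_num)]
  exact neg_one_zpow_eq_of_even ⟨2 * m, by ring⟩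

lemma tsum_lambert_residue {q : ℂ} (hq0 : q ≠ 0) (b r : ℤ) :
    ∑' m : ℤ, (-1) ^ (5 * m + r) * q ^ (3 * tri (5 * m + r) + b * (5 * m + r)) *
      (1 - q ^ (5 * (5 * m + r)))⁻¹ =
    (-1) ^ r * q ^ (3 * tri r + b * r) *
      appell ((q ^ 5) ^ 5) ((q ^ 5) ^ r) ((q ^ 5) ^ (3 * r - 6 + b)) := by
  rw [appell, ← tsum_mul_left]
  refine tsum_congr fun m => ?_
  have hz : ∀ k : ℤ, (q ^ 5) ^ k = q ^ (5 * k) := fun k => by rw [zpow_mul]; rfl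
  have hz' : ∀ k : ℤ, ((q ^ 5) ^ 5) ^ k = q ^ (25 * k) := fun k => by
    rw [← pow_mul, zpow_mul]; rfl
  rw [hz', hz', hz, hz, ← zpow_mul, ← zpow_add₀ hq0, neg_one_zpow_five_mul_add,
    three_mul_tri_five_mul_add,
    show 75 * tri m + (15 * r - 30) * m + 3 * tri r + b * (5 * m + r) =
      (3 * tri r + b * r) + (25 * (3 * tri m) + 5 * (3 * r - 6 + b) * m) by ring,
    zpow_add₀ hq0, zpow_add₀ hq0 (25 * (3 * tri m)),
    show 5 * (5 * m + r) = 5 * r + 25 * m by ring]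
  ring

lemma lambert_eq_sum {q : ℂ} (hq0 : q ≠ 0) (hq : ‖q‖ < 1) (b c : ℤ) :
    lambert q b = ∑ i ∈ Finset.range 5, (-1) ^ (c + i) * q ^ (3 * tri (c + i) + b * (c + i)) *
      appell ((q ^ 5) ^ 5) ((q ^ 5) ^ (c + i)) ((q ^ 5) ^ (3 * (c + i) - 6 + b)) := by
  simp only [lambert, tsum_int_five (summable_lambert hq0 hq b).of_norm c,
    tsum_lambert_residue hq0, Finset.sum_range_succ, Finset.sum_range_zero]
  simp

lemma tri_one : tri 1 = 1 := rfl
lemma tri_two : tri 2 = 3 := rfl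
lemma tri_three : tri 3 = 6 := rfl
lemma tri_four : tri 4 = 10 := rfl

/-- The pentagonal number series twisted by powers of `y`. -/
noncomputable def pentTwist (p y : ℂ) : ℂ := ∑' m : ℤ, (-1) ^ m * p ^ (3 * tri m - m) * y ^ m

lemma pentTwist_one (p : ℂ) : pentTwist p 1 = pentSeries p := by
  simp [pentTwist, pentSeries]

lemma pentTwist_reflect {p y : ℂ} (hp0 : p ≠ 0) : pentTwist p y = pentTwist p (p⁻¹ * y⁻¹) := by
  rw [pentTwist, ← (Equiv.neg ℤ).tsum_eq]
  refine tsum_congr fun m => ?_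
  simp only [Equiv.neg_apply]
  rw [tri_neg, mul_zpow, inv_zpow', inv_zpow', ← mul_assoc,
    mul_assoc ((-1) ^ m), ← zpow_add₀ hp0,
    neg_one_zpow_eq_of_even (a := -m) (b := m) ⟨-m, by ring⟩]
  congr 3
  ring

lemma pentTwist_shift {p y : ℂ} (hp0 : p ≠ 0) (hy : y ≠ 0) :
    pentTwist p y = -(p * y⁻¹) * pentTwist p (p ^ 2 * y⁻¹) := by
  rw [pentTwist, pentTwist, ← tsum_mul_left, ← (Equiv.subLeft (-1 : ℤ)).tsum_eq]
  refine tsum_congr fun m => ?_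
  simp only [Equiv.subLeft_apply]
  have e : 3 * tri (-1 - m) - (-1 - m) = 1 + 2 * m + (3 * tri m - m) := by
    have h1 := two_mul_tri (-1 - m)
    have h2 := two_mul_tri m
    apply mul_left_cancel₀ (two_ne_zero : (2 : ℤ) ≠ 0)
    linear_combination 3 * h1 - 3 * h2
  rw [e, neg_one_zpow_eq_neg (a := -1 - m) (b := m) ⟨-m - 1, by ring⟩, mul_zpow, zpow_add₀ hp0,
    zpow_add₀ hp0, zpow_one, zpow_sub₀ hy, zpow_neg_one, zpow_mul, inv_zpow, zpow_ofNat]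
  ring

lemma quintSeries_eq {p x : ℂ} (hp0 : p ≠ 0) (hp : ‖p‖ < 1) (hx : x ≠ 0) :
    quintSeries p x = pentTwist p (x ^ 3) + x⁻¹ * pentTwist p (x ^ 3)⁻¹ := by
  have h3 := pow_ne_zero 3 hx
  have s1 := (summable_pent hp0 hp h3).of_norm
  have s2 := (summable_pent hp0 hp (inv_ne_zero h3)).of_norm.mul_left x⁻¹
  rw [pentTwist, pentTwist, ← tsum_mul_left, ← s1.tsum_add s2]
  refine tsum_congr fun m => ?_
  rw [zpow_sub_one₀ hx, neg_mul, zpow_neg, zpow_mul, inv_zpow, zpow_ofNat]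
  ring

/-- The 5-dissection of the Euler product. -/
theorem pentSeries_dissection {q : ℂ} (hq0 : q ≠ 0) (hq : ‖q‖ < 1 / 16) :
    pentSeries q = pentSeries ((q ^ 5) ^ 5) *
      (jtRatio (q ^ 5) - q - q ^ 2 / jtRatio (q ^ 5)) := by
  have hQ0 : q ^ 5 ≠ 0 := pow_ne_zero 5 hq0
  have hQ : ‖q ^ 5‖ < 1 / 16 := norm_pow_lt_one hq (by norm_num)
  have hp0 : (q ^ 5) ^ 5 ≠ 0 := pow_ne_zero 5 hQ0
  have hp := norm_pow_five_lt_one hQ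
  have hz : ∀ k : ℤ, (q ^ 5) ^ k = q ^ (5 * k) := fun k => by rw [zpow_mul]; rfl
  have hz' : ∀ k : ℤ, ((q ^ 5) ^ 5) ^ k = q ^ (25 * k) := fun k => by
    rw [← pow_mul, zpow_mul]; rfl
  have hterm : ∀ r m : ℤ, (-1 : ℂ) ^ (5 * m + r) * q ^ (3 * tri (5 * m + r) - (5 * m + r)) =
      (-1) ^ r * q ^ (3 * tri r - r) * ((-1) ^ m * ((q ^ 5) ^ 5) ^ (3 * tri m - m) *
        ((q ^ 5) ^ (3 * r - 2)) ^ m) := by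
    intro r m
    rw [hz', ← zpow_mul, hz, neg_one_zpow_five_mul_add, three_mul_tri_five_mul_add,
      show 75 * tri m + (15 * r - 30) * m + 3 * tri r - (5 * m + r) =
        (3 * tri r - r) + (25 * (3 * tri m - m) + 5 * ((3 * r - 2) * m)) by ring,
      zpow_add₀ hq0, zpow_add₀ hq0 (25 * (3 * tri m - m))]
    ring
  have hres : ∀ r : ℤ, ∑' m : ℤ, (-1 : ℂ) ^ (5 * m + r) * q ^ (3 * tri (5 * m + r) - (5 * m + r)) =
      (-1) ^ r * q ^ (3 * tri r - r) * pentTwist ((q ^ 5) ^ 5) ((q ^ 5) ^ (3 * r - 2)) := by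
    intro r
    rw [pentTwist, ← tsum_mul_left]
    exact tsum_congr fun m => hterm r m
  have hs := (summable_pent_one hq0 (hq.trans (by norm_num))).of_norm
  rw [pentSeries, tsum_int_five hs (-2), hres, hres, hres, hres, hres]
  have v1 := quintSeries_inv hQ0 hQ
  have v2 := quintSeries_inv_sq hQ0 hQ
  rw [quintSeries_eq hp0 hp (inv_ne_zero hQ0)] at v1
  rw [quintSeries_eq hp0 hp (inv_ne_zero (pow_ne_zero 2 hQ0))] at v2
  have w0 := pentTwist_reflect (y := ((q ^ 5) ^ 2)⁻¹) hp0
  have w1 := pentTwist_reflect (y := ((q ^ 5) ^ 8)⁻¹) hp0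
  have w2 := pentTwist_reflect (y := ((q ^ 5) ^ 5)⁻¹) hp0
  have w3 := pentTwist_reflect (y := q ^ 5) hp0
  have w4 := pentTwist_shift (y := (q ^ 5) ^ 4) hp0 (pow_ne_zero 4 hQ0)
  have x0 : ((q ^ 5) ^ 5)⁻¹ * (((q ^ 5) ^ 2)⁻¹)⁻¹ = (q ^ 5)⁻¹ ^ 3 := by field_simp
  have x1 : ((q ^ 5) ^ 5)⁻¹ * (((q ^ 5) ^ 8)⁻¹)⁻¹ = ((q ^ 5)⁻¹ ^ 3)⁻¹ := by field_simp
  have x2 : ((q ^ 5) ^ 5)⁻¹ * (((q ^ 5) ^ 5)⁻¹)⁻¹ = 1 := by field_simp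
  have x3 : ((q ^ 5) ^ 5)⁻¹ * (q ^ 5)⁻¹ = ((q ^ 5) ^ 2)⁻¹ ^ 3 := by field_simp
  have x4 : ((q ^ 5) ^ 5) ^ 2 * ((q ^ 5) ^ 4)⁻¹ = (((q ^ 5) ^ 2)⁻¹ ^ 3)⁻¹ := by field_simp
  rw [x0] at w0
  rw [x1] at w1
  rw [x2, pentTwist_one] at w2
  rw [x3] at w3
  rw [x4] at w4
  norm_num [tri_zero, tri_one, tri_two, show tri (-1) = 0 from rfl, show tri (-2) = 1 from rfl]
  rw [w0, w1, w2, w3, w4]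
  have e4 : (q ^ 5) ^ 5 * ((q ^ 5) ^ 4)⁻¹ = q ^ 5 := by field_simp
  rw [e4]
  rw [inv_inv] at v1 v2
  linear_combination v1 - q ^ 2 * v2

lemma one_add_lambert_zero {q : ℂ} (hq0 : q ≠ 0) (hq : ‖q‖ < 1 / 16) :
    1 + 5 * lambert q 0 = (jtRatio (q ^ 5) - q - q ^ 2 / jtRatio (q ^ 5)) *
      (-5 * q ^ 8 * appell ((q ^ 5) ^ 5) ((q ^ 5) ^ 2) 1 + pfA ((q ^ 5) ^ 5) ((q ^ 5) ^ 2) *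
        (jtRatio (q ^ 5) ^ 2 + q * jtRatio (q ^ 5) + 2 * q ^ 2 - 2 * q ^ 3 / jtRatio (q ^ 5))) := by
  have hQ0 : q ^ 5 ≠ 0 := pow_ne_zero 5 hq0
  have hQ : ‖q ^ 5‖ < 1 / 16 := norm_pow_lt_one hq (by norm_num)
  have ha := jtRatio_ne_zero hQ0 hQ
  have r1 := thetaLog_relation_one hQ0 hQ
  have r2 := thetaLog_relation_two hQ0 hQ
  rw [pfA_self hQ0 hQ] at r1
  have hT : lambert q 0 = q ^ 9 * appell ((q ^ 5) ^ 5) ((q ^ 5) ^ 2) 1 -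
      q ^ 3 * ((q ^ 5) ^ 3 * appell ((q ^ 5) ^ 5) ((q ^ 5) ^ 3) ((q ^ 5) ^ 3) +
        appell ((q ^ 5) ^ 5) (q ^ 5) ((q ^ 5) ^ 3)⁻¹) +
      ((q ^ 5) ^ 6 * appell ((q ^ 5) ^ 5) ((q ^ 5) ^ 4) ((q ^ 5) ^ 6) +
        appell ((q ^ 5) ^ 5) 1 ((q ^ 5) ^ 6)⁻¹) := by
    rw [lambert_eq_sum hq0 (hq.trans (by norm_num)) 0 0]
    norm_num [Finset.sum_range_succ, tri_zero, tri_one, tri_two, tri_three, tri_four]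
    ring
  rw [hT, appell_pair_one hQ0 hQ, appell_pair_two hQ0 hQ]
  generalize jtRatio (q ^ 5) = a, appell ((q ^ 5) ^ 5) ((q ^ 5) ^ 2) 1 = F,
    pfA ((q ^ 5) ^ 5) ((q ^ 5) ^ 2) = A, thetaLog ((q ^ 5) ^ 5) (q ^ 5) = D1,
    thetaLog ((q ^ 5) ^ 5) ((q ^ 5) ^ 2) = D2 at *
  have key : 1 + 5 * (D2 - D1) = A * (a ^ 3 + 2 * q ^ 5 / a ^ 2) := by
    linear_combination 2 * r2 - r1
  have key2 : a ^ 3 + 2 * q ^ 5 / a ^ 2 - 5 * q ^ 3 = (a - q - q ^ 2 / a) *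
      (a ^ 2 + q * a + 2 * q ^ 2 - 2 * q ^ 3 / a) := by
    field_simp
    ring
  have key3 : q ^ 9 * F - q ^ 3 * (q ^ 5 * a * F) + (q ^ 5) ^ 2 / a * F =
      -(a - q - q ^ 2 / a) * (q ^ 8 * F) := by
    field_simp
    ring
  linear_combination key + A * key2 + 5 * key3

lemma two_sub_lambert_three {q : ℂ} (hq0 : q ≠ 0) (hq : ‖q‖ < 1 / 16) :
    2 - 5 * lambert q 3 = (jtRatio (q ^ 5) - q - q ^ 2 / jtRatio (q ^ 5)) *
      (-5 * q ^ 5 * appell ((q ^ 5) ^ 5) (q ^ 5) 1 + pfA ((q ^ 5) ^ 5) (q ^ 5) *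
        (2 * jtRatio (q ^ 5) + 2 * q - q ^ 2 / jtRatio (q ^ 5) +
          q ^ 3 / jtRatio (q ^ 5) ^ 2)) := by
  have hQ0 : q ^ 5 ≠ 0 := pow_ne_zero 5 hq0
  have hQ : ‖q ^ 5‖ < 1 / 16 := norm_pow_lt_one hq (by norm_num)
  have ha := jtRatio_ne_zero hQ0 hQ
  have r1 := thetaLog_relation_one hQ0 hQ
  have r2 := thetaLog_relation_two hQ0 hQ
  have hA := pfA_self hQ0 hQ
  have hT : lambert q 3 = -q ^ 6 * appell ((q ^ 5) ^ 5) (q ^ 5) 1 +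
      ((q ^ 5) ^ 3 * appell ((q ^ 5) ^ 5) ((q ^ 5) ^ 2) ((q ^ 5) ^ 3) +
        appell ((q ^ 5) ^ 5) 1 ((q ^ 5) ^ 3)⁻¹) -
      (q ^ 3)⁻¹ * ((q ^ 5) ^ 6 * appell ((q ^ 5) ^ 5) ((q ^ 5) ^ 3) ((q ^ 5) ^ 6) +
        appell ((q ^ 5) ^ 5) (q ^ 5)⁻¹ ((q ^ 5) ^ 6)⁻¹) := by
    rw [lambert_eq_sum hq0 (hq.trans (by norm_num)) 3 (-1)]
    norm_num [Finset.sum_range_succ, tri_zero, tri_one, tri_two, tri_three,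
      show tri (-1) = 0 from rfl]
    generalize appell ((q ^ 5) ^ 5) (q ^ 5)⁻¹ ((q ^ 5) ^ 6)⁻¹ = L1,
      appell ((q ^ 5) ^ 5) 1 ((q ^ 5) ^ 3)⁻¹ = L2
    field_simp
    ring
  rw [hT, appell_pair_three hQ0 hQ, appell_pair_four hQ0 hQ]
  generalize jtRatio (q ^ 5) = a, appell ((q ^ 5) ^ 5) (q ^ 5) 1 = F,
    pfA ((q ^ 5) ^ 5) ((q ^ 5) ^ 2) = A, pfA ((q ^ 5) ^ 5) (q ^ 5) = B,
    thetaLog ((q ^ 5) ^ 5) (q ^ 5) = D1, thetaLog ((q ^ 5) ^ 5) ((q ^ 5) ^ 2) = D2 at *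
  have key : 2 - 5 * (D1 + D2) = B * (2 * a ^ 2 - q ^ 5 / a ^ 3) := by
    have h : q ^ 5 * A / a ^ 2 = B * (q ^ 5 / a ^ 3) := by
      rw [hA]
      field_simp
    linear_combination (-2) * r1 - r2 - h
  have key2 : 2 * a ^ 2 - 5 * q ^ 2 - q ^ 5 / a ^ 3 = (a - q - q ^ 2 / a) *
      (2 * a + 2 * q - q ^ 2 / a + q ^ 3 / a ^ 2) := by
    field_simp
    ring
  have key3 : -q ^ 6 * F + q ^ 5 * a * F - (q ^ 3)⁻¹ * ((q ^ 5) ^ 2 / a * F - q ^ 5 * B) =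
      (a - q - q ^ 2 / a) * (q ^ 5 * F) + q ^ 2 * B := by
    field_simp
    ring
  linear_combination key + B * key2 - 5 * key3

/-- Both rank generating functions are free of the residue class `4` modulo `5`. -/
theorem exists_lambert_dissection : ∃ X Y : ℕ → ℂ → ℂ, ∀ q : ℂ, q ≠ 0 → ‖q‖ < 1 / 16 →
    1 + 5 * lambert q 0 = pentSeries q * ∑ c ∈ Finset.range 4, q ^ c * X c (q ^ 5) ∧
    2 - 5 * lambert q 3 = pentSeries q * ∑ c ∈ Finset.range 4, q ^ c * Y c (q ^ 5) := by
  let E : ℂ → ℂ := fun Q => pentSeries (Q ^ 5)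
  let X : ℕ → ℂ → ℂ := fun c Q => (E Q)⁻¹ * match c with
    | 0 => pfA (Q ^ 5) (Q ^ 2) * jtRatio Q ^ 2
    | 1 => pfA (Q ^ 5) (Q ^ 2) * jtRatio Q
    | 2 => 2 * pfA (Q ^ 5) (Q ^ 2)
    | _ => -5 * Q * appell (Q ^ 5) (Q ^ 2) 1 - 2 * pfA (Q ^ 5) (Q ^ 2) / jtRatio Q
  let Y : ℕ → ℂ → ℂ := fun c Q => (E Q)⁻¹ * match c with
    | 0 => -5 * Q * appell (Q ^ 5) Q 1 + 2 * pfA (Q ^ 5) Q * jtRatio Q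
    | 1 => 2 * pfA (Q ^ 5) Q
    | 2 => -(pfA (Q ^ 5) Q / jtRatio Q)
    | _ => pfA (Q ^ 5) Q / jtRatio Q ^ 2
  refine ⟨X, Y, fun q hq0 hq => ?_⟩
  have hQ0 : q ^ 5 ≠ 0 := pow_ne_zero 5 hq0
  have hE : pentSeries ((q ^ 5) ^ 5) ≠ 0 := pentSeries_ne_zero (pow_ne_zero 5 hQ0)
    (norm_pow_lt_one (norm_pow_lt_one hq (by norm_num)) (by norm_num))
  rw [one_add_lambert_zero hq0 hq, two_sub_lambert_three hq0 hq, pentSeries_dissection hq0 hq]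
  simp only [Finset.sum_range_succ, Finset.sum_range_zero, X, Y, E]
  generalize pentSeries ((q ^ 5) ^ 5) = G at *
  generalize jtRatio (q ^ 5) - q - q ^ 2 / jtRatio (q ^ 5) = H
  constructor <;> field_simp <;> ring

/-- The multisets of parts of the partitions of `n`. -/
def partMultisets (n : ℕ) : Finset (Multiset ℕ) :=
  (Finset.univ : Finset (Nat.Partition n)).map ⟨Nat.Partition.parts, fun _ _ => Nat.Partition.ext⟩

lemma mem_partMultisets {n : ℕ} {s : Multiset ℕ} :
    s ∈ partMultisets n ↔ (∀ i ∈ s, 0 < i) ∧ s.sum = n := by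
  simp only [partMultisets, Finset.mem_map, Finset.mem_univ, true_and]
  constructor
  · rintro ⟨p, rfl⟩
    exact ⟨fun i => p.parts_pos, p.parts_sum⟩
  · rintro ⟨h1, h2⟩
    exact ⟨⟨s, fun {i} => h1 i, h2⟩, rfl⟩

/-- The rank of a multiset of parts. -/
def multisetRank (s : Multiset ℕ) : ℤ := (s.sup : ℤ) - Multiset.card s

lemma card_filter_partitionRank {n : ℕ} (P : ℤ → Prop) [DecidablePred P] :
    (Finset.univ.filter fun p : Nat.Partition n => P (partitionRank p)).card =
      ((partMultisets n).filter fun s => P (multisetRank s)).card := by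
  rw [partMultisets, Finset.filter_map, Finset.card_map]
  rfl

/-- Dyson's map: remove the first column and insert a part of size `ℓ + r`, where `ℓ` is the number
of parts. -/
def dysonMap (r : ℤ) (s : Multiset ℕ) : Multiset ℕ :=
  ((Multiset.card s + r).toNat ::ₘ s.map Nat.pred).filter (0 < ·)

/-- The inverse of Dyson's map. -/
def dysonInv (r : ℤ) (s : Multiset ℕ) : Multiset ℕ :=
  (s.erase s.sup).map Nat.succ +
    Multiset.replicate ((s.sup - r).toNat - Multiset.card (s.erase s.sup)) 1

lemma sum_map_pred {s : Multiset ℕ} (h : ∀ i ∈ s, 0 < i) :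
    (s.map Nat.pred).sum + Multiset.card s = s.sum := by
  induction s using Multiset.induction_on with
  | empty => simp
  | cons a s ih =>
    have h1 := ih fun i hi => h i (Multiset.mem_cons_of_mem hi)
    have h2 := h a (Multiset.mem_cons_self a s)
    simp only [Multiset.map_cons, Multiset.sum_cons, Multiset.card_cons, Nat.pred_eq_sub_one] at *
    omega

lemma sum_filter_pos (s : Multiset ℕ) : (s.filter (0 < ·)).sum = s.sum := by
  induction s using Multiset.induction_on with
  | empty => simp
  | cons a s ih =>
    rcases Nat.eq_zero_or_pos a with rfl | h
    · simp [ih]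
    · simp [h, ih]

lemma sum_map_succ (s : Multiset ℕ) : (s.map Nat.succ).sum = s.sum + Multiset.card s := by
  induction s using Multiset.induction_on with
  | empty => simp
  | cons a s ih => simp [ih]; ring

lemma sup_filter_pos (s : Multiset ℕ) : (s.filter (0 < ·)).sup = s.sup := by
  induction s using Multiset.induction_on with
  | empty => simp
  | cons a s ih =>
    rcases Nat.eq_zero_or_pos a with rfl | h
    · simp [ih]
    · simp [h, ih]

lemma map_succ_filter_pred_add {s : Multiset ℕ} (h : ∀ i ∈ s, 0 < i) :
    ((s.map Nat.pred).filter (0 < ·)).map Nat.succ + Multiset.replicate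
      (Multiset.card s - Multiset.card ((s.map Nat.pred).filter (0 < ·))) 1 = s := by
  induction s using Multiset.induction_on with
  | empty => simp
  | cons a s ih =>
    have h1 := ih fun i hi => h i (Multiset.mem_cons_of_mem hi)
    have h2 := h a (Multiset.mem_cons_self a s)
    have h3 : Multiset.card ((s.map Nat.pred).filter (0 < ·)) ≤ Multiset.card s := by
      simpa using Multiset.card_le_card (Multiset.filter_le (0 < ·) (s.map Nat.pred))
    rcases (show 1 ≤ a from h2).eq_or_lt with rfl | ha
    · rw [Multiset.map_cons, Multiset.filter_cons_of_neg _ (by simp), Multiset.card_cons,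
        Nat.succ_sub h3, Multiset.replicate_succ, Multiset.add_cons, h1]
    · obtain ⟨b, rfl⟩ : ∃ b, a = b + 1 := ⟨a - 1, by omega⟩
      have hb : 0 < b := by omega
      simp only [Multiset.map_cons, Nat.pred_eq_sub_one, Nat.add_sub_cancel]
      rw [Multiset.filter_cons_of_pos _ hb, Multiset.map_cons, Multiset.cons_add,
        Multiset.card_cons, Multiset.card_cons, Nat.add_sub_add_right]
      simpa using h1

lemma sup_mem_of_mem {s : Multiset ℕ} {a : ℕ} (ha : a ∈ s) : s.sup ∈ s := by
  obtain ⟨y, hy, hmax⟩ := Multiset.exists_max_image (id : ℕ → ℕ) (s := s) (by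
    rintro rfl; simp at ha)
  rwa [le_antisymm (Multiset.sup_le.2 hmax) (Multiset.le_sup hy)]

lemma filter_pos_sup_cons_erase {s : Multiset ℕ} (h : ∀ i ∈ s, 0 < i) :
    (s.sup ::ₘ s.erase s.sup).filter (0 < ·) = s := by
  rcases s.empty_or_exists_mem with rfl | ⟨a, ha⟩
  · simp
  · rw [Multiset.cons_erase (sup_mem_of_mem ha), Multiset.filter_eq_self.2 h]

lemma sup_dysonMap {r : ℤ} {s : Multiset ℕ} (h1 : multisetRank s ≤ r + 1) :
    (dysonMap r s).sup = (Multiset.card s + r).toNat := by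
  rw [dysonMap, sup_filter_pos, Multiset.sup_cons, sup_eq_left, Multiset.sup_le]
  intro b hb
  obtain ⟨a, ha, rfl⟩ := Multiset.mem_map.1 hb
  have := Multiset.le_sup ha
  rw [multisetRank] at h1
  rw [Nat.pred_eq_sub_one]
  omega

lemma card_dysonMap_le (r : ℤ) (s : Multiset ℕ) :
    Multiset.card (dysonMap r s) ≤ Multiset.card s + 1 := by
  simpa [dysonMap] using Multiset.card_le_card
    (Multiset.filter_le (0 < ·) ((Multiset.card s + r).toNat ::ₘ s.map Nat.pred))

lemma dysonInv_dysonMap {r : ℤ} {s : Multiset ℕ} (h : ∀ i ∈ s, 0 < i)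
    (h1 : multisetRank s ≤ r + 1) (h2 : 0 ≤ Multiset.card s + r) :
    dysonInv r (dysonMap r s) = s := by
  have he : (dysonMap r s).erase (Multiset.card s + r).toNat =
      (s.map Nat.pred).filter (0 < ·) := by
    rcases Nat.eq_zero_or_pos (Multiset.card s + r).toNat with h0 | h0
    · rw [dysonMap, h0, Multiset.filter_cons_of_neg _ (by simp), Multiset.erase_of_notMem]
      simp
    · rw [dysonMap, Multiset.filter_cons_of_pos (p := (0 < ·)) _ h0, Multiset.erase_cons_head]
  rw [dysonInv, sup_dysonMap h1, he,
    show (((Multiset.card s + r).toNat : ℤ) - r).toNat = Multiset.card s by omega]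
  exact map_succ_filter_pred_add h

lemma card_erase_sup_le {r : ℤ} {s : Multiset ℕ} (h1 : r - 1 ≤ multisetRank s)
    (h2 : 0 ≤ s.sup - r) : Multiset.card (s.erase s.sup) ≤ (s.sup - r).toNat := by
  rw [multisetRank] at h1
  rcases s.empty_or_exists_mem with rfl | ⟨a, ha⟩
  · simp
  · rw [Multiset.card_erase_of_mem (sup_mem_of_mem ha), Nat.pred_eq_sub_one]
    omega

lemma card_dysonInv {r : ℤ} {s : Multiset ℕ} (h1 : r - 1 ≤ multisetRank s)
    (h2 : 0 ≤ s.sup - r) : Multiset.card (dysonInv r s) = (s.sup - r).toNat := by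
  rw [dysonInv, Multiset.card_add, Multiset.card_map, Multiset.card_replicate]
  exact Nat.add_sub_cancel' (card_erase_sup_le h1 h2)

lemma dysonMap_dysonInv {r : ℤ} {s : Multiset ℕ} (h : ∀ i ∈ s, 0 < i)
    (h1 : r - 1 ≤ multisetRank s) (h2 : 0 ≤ s.sup - r) : dysonMap r (dysonInv r s) = s := by
  rw [dysonMap, card_dysonInv h1 h2, show ((s.sup - r).toNat + r).toNat = s.sup by omega,
    dysonInv, Multiset.map_add, Multiset.map_map, Multiset.map_replicate]
  have e : (s.erase s.sup).map (Nat.pred ∘ Nat.succ) = s.erase s.sup := by simp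
  rw [e, ← Multiset.cons_add, Multiset.filter_add, filter_pos_sup_cons_erase h,
    Multiset.filter_eq_nil.2, add_zero]
  intro a ha
  simp [Multiset.eq_of_mem_replicate ha]

lemma sum_erase_sup (s : Multiset ℕ) : s.sup + (s.erase s.sup).sum = s.sum := by
  rcases s.empty_or_exists_mem with rfl | ⟨a, ha⟩
  · simp
  · rw [← Multiset.sum_cons, Multiset.cons_erase (sup_mem_of_mem ha)]

lemma sum_dysonInv {r : ℤ} {s : Multiset ℕ} (h1 : r - 1 ≤ multisetRank s)
    (h2 : 0 ≤ s.sup - r) : ((dysonInv r s).sum : ℤ) = s.sum - r := by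
  have e := sum_erase_sup s
  have c := card_erase_sup_le h1 h2
  rw [dysonInv, Multiset.sum_add, sum_map_succ, Multiset.sum_replicate, smul_eq_mul, mul_one]
  omega

lemma sum_dysonMap {r : ℤ} {s : Multiset ℕ} (h : ∀ i ∈ s, 0 < i)
    (h2 : 0 ≤ Multiset.card s + r) : ((dysonMap r s).sum : ℤ) = s.sum + r := by
  have := sum_map_pred h
  rw [dysonMap, sum_filter_pos, Multiset.sum_cons]
  omega

lemma sup_dysonInv_le (r : ℤ) (s : Multiset ℕ) : (dysonInv r s).sup ≤ s.sup + 1 := by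
  rw [dysonInv, Multiset.sup_add, sup_le_iff, Multiset.sup_le, Multiset.sup_le]
  constructor
  · intro b hb
    obtain ⟨a, ha, rfl⟩ := Multiset.mem_map.1 hb
    exact Nat.succ_le_succ (Multiset.le_sup (Multiset.mem_of_mem_erase ha))
  · intro b hb
    rw [Multiset.eq_of_mem_replicate hb]
    omega

/-- Dyson's bijection, as an equality of cardinalities. -/
theorem card_rank_le_eq_card_le_rank {n n' : ℕ} {r : ℤ} (hn : (n' : ℤ) = n + r)
    (hr : 1 ≤ r ∨ r ≤ -2) :
    (Finset.univ.filter fun p : Nat.Partition n => partitionRank p ≤ r + 1).card =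
      (Finset.univ.filter fun p : Nat.Partition n' => r - 1 ≤ partitionRank p).card := by
  rw [card_filter_partitionRank (· ≤ r + 1), card_filter_partitionRank (r - 1 ≤ ·)]
  have hsrc : ∀ s ∈ (partMultisets n).filter fun s => multisetRank s ≤ r + 1,
      (∀ i ∈ s, 0 < i) ∧ s.sum = n ∧ multisetRank s ≤ r + 1 ∧ 0 ≤ Multiset.card s + r := by
    intro s hs
    rw [Finset.mem_filter, mem_partMultisets] at hs
    refine ⟨hs.1.1, hs.1.2, hs.2, ?_⟩
    have h := hs.2
    rw [multisetRank] at h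
    rcases hr with hr | hr
    · omega
    · rcases s.empty_or_exists_mem with rfl | ⟨a, ha⟩
      · simp at h; omega
      · have := hs.1.1 _ (sup_mem_of_mem ha)
        omega
  have htgt : ∀ s ∈ (partMultisets n').filter fun s => r - 1 ≤ multisetRank s,
      (∀ i ∈ s, 0 < i) ∧ s.sum = n' ∧ r - 1 ≤ multisetRank s ∧ 0 ≤ s.sup - r := by
    intro s hs
    rw [Finset.mem_filter, mem_partMultisets] at hs
    refine ⟨hs.1.1, hs.1.2, hs.2, ?_⟩
    have h := hs.2
    rw [multisetRank] at h
    rcases hr with hr | hr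
    · rcases s.empty_or_exists_mem with rfl | ⟨a, ha⟩
      · have := hs.1.2
        simp at this; omega
      · have := Multiset.card_pos_iff_exists_mem.2 ⟨a, ha⟩
        omega
    · omega
  refine Finset.card_nbij' (dysonMap r) (dysonInv r) (fun s hs => ?_) (fun s hs => ?_)
    (fun s hs => ?_) (fun s hs => ?_)
  · obtain ⟨h, hsum, h1, h2⟩ := hsrc s hs
    simp only [Finset.coe_filter, Set.mem_ofPred_eq, mem_partMultisets]
    refine ⟨⟨fun i hi => (Multiset.mem_filter.1 hi).2, ?_⟩, ?_⟩
    · have := sum_dysonMap h h2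
      omega
    · have := card_dysonMap_le r s
      rw [multisetRank, sup_dysonMap h1]
      omega
  · obtain ⟨h, hsum, h1, h2⟩ := htgt s hs
    simp only [Finset.coe_filter, Set.mem_ofPred_eq, mem_partMultisets]
    refine ⟨⟨fun i hi => ?_, ?_⟩, ?_⟩
    · rw [dysonInv, Multiset.mem_add, Multiset.mem_map] at hi
      rcases hi with ⟨a, -, rfl⟩ | hi
      · exact Nat.succ_pos a
      · rw [Multiset.eq_of_mem_replicate hi]
        exact Nat.one_pos
    · have := sum_dysonInv h1 h2
      omega
    · have := sup_dysonInv_le r s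
      rw [multisetRank, card_dysonInv h1 h2]
      omega
  · obtain ⟨h, -, h1, h2⟩ := hsrc s hs
    exact dysonInv_dysonMap h h1 h2
  · obtain ⟨h, -, h1, h2⟩ := htgt s hs
    exact dysonMap_dysonInv h h1 h2

/-- The number of partitions of `n` of rank at least `m`. -/
def rankCount (m n : ℕ) : ℕ :=
  (Finset.univ.filter fun p : Nat.Partition n => (m : ℤ) ≤ partitionRank p).card

/-- The number of partitions of `n` of rank at most `-m`. -/
def negRankCount (m n : ℕ) : ℕ :=
  (Finset.univ.filter fun p : Nat.Partition n => partitionRank p ≤ -(m : ℤ)).card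

lemma sup_le_of_partition {n : ℕ} (p : Nat.Partition n) : p.parts.sup ≤ n :=
  Multiset.sup_le.2 fun i hi => by
    have := Multiset.single_le_sum (fun x _ => Nat.zero_le x) i hi
    rwa [p.parts_sum] at this

lemma card_le_of_partition {n : ℕ} (p : Nat.Partition n) : Multiset.card p.parts ≤ n := by
  have h := Multiset.card_nsmul_le_sum (s := p.parts) (a := 1) fun x hx => p.parts_pos hx
  simpa [p.parts_sum] using h

lemma card_pos_of_partition {n : ℕ} (hn : n ≠ 0) (p : Nat.Partition n) :
    0 < Multiset.card p.parts := by
  rw [Multiset.card_pos]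
  intro h
  have := p.parts_sum
  rw [h, Multiset.sum_zero] at this
  exact hn this.symm

lemma sup_pos_of_partition {n : ℕ} (hn : n ≠ 0) (p : Nat.Partition n) : 0 < p.parts.sup := by
  obtain ⟨a, ha⟩ := Multiset.card_pos_iff_exists_mem.1 (card_pos_of_partition hn p)
  exact (p.parts_pos ha).trans_le (Multiset.le_sup ha)

lemma abs_partitionRank_lt {n : ℕ} (hn : n ≠ 0) (p : Nat.Partition n) :
    |partitionRank p| < n := by
  have h1 := sup_le_of_partition p
  have h2 := card_le_of_partition p
  have h3 := sup_pos_of_partition hn p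
  have h4 := card_pos_of_partition hn p
  rw [partitionRank, abs_lt]
  constructor <;> omega

lemma abs_partitionRank_le {n : ℕ} (p : Nat.Partition n) : |partitionRank p| ≤ n := by
  have h1 := sup_le_of_partition p
  have h2 := card_le_of_partition p
  rw [partitionRank, abs_le]
  constructor <;> omega

lemma abs_partitionRank_lt_of_le {m n : ℕ} (hm : 1 ≤ m) (hnm : n ≤ m) (p : Nat.Partition n) :
    |partitionRank p| < m := by
  rcases Nat.eq_zero_or_pos n with rfl | hn
  · have := abs_partitionRank_le p
    push_cast at this
    omega
  · have := abs_partitionRank_lt hn.ne' p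
    omega

lemma rankCount_eq_zero {m n : ℕ} (hm : 1 ≤ m) (hnm : n ≤ m) : rankCount m n = 0 := by
  rw [rankCount, Finset.card_eq_zero, Finset.filter_eq_empty_iff]
  intro p _
  have := abs_lt.1 (abs_partitionRank_lt_of_le hm hnm p)
  omega

lemma negRankCount_eq_zero {m n : ℕ} (hm : 1 ≤ m) (hnm : n ≤ m) : negRankCount m n = 0 := by
  rw [negRankCount, Finset.card_eq_zero, Finset.filter_eq_empty_iff]
  intro p _
  have := abs_lt.1 (abs_partitionRank_lt_of_le hm hnm p)
  omega

lemma rankCount_add_rankCount (m k : ℕ) :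
    rankCount m (k + m + 1) + rankCount (m + 3) k = Fintype.card (Nat.Partition k) := by
  have h := card_rank_le_eq_card_le_rank (n := k) (n' := k + m + 1) (r := m + 1)
    (by push_cast; ring) (Or.inl (by omega))
  rw [rankCount, rankCount, ← Finset.card_univ,
    ← Finset.card_filter_add_card_filter_not (s := (Finset.univ : Finset (Nat.Partition k)))
      (fun p => partitionRank p ≤ (m : ℤ) + 1 + 1), h]
  congr 2
  · ext p
    simp
  · ext p
    simp only [Finset.mem_filter, Finset.mem_univ, true_and]
    push_cast
    omega

lemma negRankCount_add_negRankCount {m : ℕ} (hm : 1 ≤ m) (k : ℕ) :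
    negRankCount m (k + m + 1) + negRankCount (m + 3) k = Fintype.card (Nat.Partition k) := by
  have h := card_rank_le_eq_card_le_rank (n := k + m + 1) (n' := k) (r := -(m + 1))
    (by push_cast; ring) (Or.inr (by omega))
  rw [negRankCount, negRankCount, ← Finset.card_univ,
    ← Finset.card_filter_add_card_filter_not (s := (Finset.univ : Finset (Nat.Partition k)))
      (fun p => -((m : ℤ) + 1) - 1 ≤ partitionRank p), ← h]
  congr 2
  · ext p
    simp
  · ext p
    simp only [Finset.mem_filter, Finset.mem_univ, true_and]
    push_cast
    omega

lemma negRankCount_eq_rankCount {m : ℕ} (hm : 1 ≤ m) (n : ℕ) :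
    negRankCount m n = rankCount m n := by
  induction n using Nat.strong_induction_on generalizing m with
  | _ n ih =>
    rcases le_or_gt n m with hnm | hnm
    · rw [rankCount_eq_zero hm hnm, negRankCount_eq_zero hm hnm]
    · obtain ⟨k, rfl⟩ : ∃ k, n = k + m + 1 := ⟨n - m - 1, by omega⟩
      have h1 := rankCount_add_rankCount m k
      have h2 := negRankCount_add_negRankCount hm k
      have h3 := ih k (by omega) (show 1 ≤ m + 3 by omega)
      omega

lemma card_partition_eq (n : ℕ) :
    Fintype.card (Nat.Partition n) = rankCount 0 n + rankCount 1 n := by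
  rw [← negRankCount_eq_rankCount le_rfl, rankCount, negRankCount, ← Finset.card_univ,
    ← Finset.card_filter_add_card_filter_not (s := (Finset.univ : Finset (Nat.Partition n)))
      (fun p => ((0 : ℕ) : ℤ) ≤ partitionRank p)]
  congr 2
  ext p
  simp only [Finset.mem_filter, Finset.mem_univ, true_and]
  push_cast
  omega

lemma card_partition_le_two_pow (n : ℕ) : Fintype.card (Nat.Partition n) ≤ 2 ^ n := by
  refine (Fintype.card_le_of_surjective _ Nat.Partition.ofComposition_surj).trans ?_
  rw [composition_card]
  exact Nat.pow_le_pow_right two_pos (Nat.sub_le _ _)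

lemma rankCount_le (m n : ℕ) : rankCount m n ≤ Fintype.card (Nat.Partition n) :=
  Finset.card_filter_le _ _

lemma rankCount_le_two_pow (m n : ℕ) : rankCount m n ≤ 2 ^ n :=
  (rankCount_le m n).trans (card_partition_le_two_pow n)

/-- The number of partitions of `n` of rank congruent to `k` modulo `5`. -/
def rankModCount (k n : ℕ) : ℕ :=
  (Finset.univ.filter fun p : Nat.Partition n => partitionRank p % 5 = k).card

lemma indicator_sum_eq {n k : ℕ} (hk : 1 ≤ k) (hk4 : k ≤ 4) {r : ℤ} (hr : |r| ≤ n) :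
    (if r % 5 = k then 1 else 0 : ℤ) =
      ∑ i ∈ Finset.range (n + 1),
        (((if ((5 * i + k : ℕ) : ℤ) ≤ r then 1 else 0) -
            (if ((5 * i + k + 1 : ℕ) : ℤ) ≤ r then 1 else 0)) +
          ((if r ≤ -((5 * i + (5 - k) : ℕ) : ℤ) then 1 else 0) -
            (if r ≤ -((5 * i + (5 - k) + 1 : ℕ) : ℤ) then 1 else 0))) := by
  have hr' := abs_le.1 hr
  have h0 : ∀ i : ℕ, i ≠ (if 0 ≤ r then r / 5 else -r / 5).toNat →
      (((if ((5 * i + k : ℕ) : ℤ) ≤ r then 1 else 0) -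
            (if ((5 * i + k + 1 : ℕ) : ℤ) ≤ r then 1 else 0)) +
          ((if r ≤ -((5 * i + (5 - k) : ℕ) : ℤ) then 1 else 0) -
            (if r ≤ -((5 * i + (5 - k) + 1 : ℕ) : ℤ) then 1 else 0)) : ℤ) = 0 := by
    intro i hi
    split_ifs at hi ⊢ <;> omega
  rw [Finset.sum_eq_single (if 0 ≤ r then r / 5 else -r / 5).toNat (fun i _ => h0 i)]
  · split_ifs <;> omega
  · intro h
    exfalso
    apply h
    rw [Finset.mem_range]
    split_ifs <;> omega

lemma rankModCount_eq_sum {k : ℕ} (hk : 1 ≤ k) (hk4 : k ≤ 4) (n : ℕ) :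
    (rankModCount k n : ℤ) = ∑ i ∈ Finset.range (n + 1),
      (((rankCount (5 * i + k) n : ℤ) - rankCount (5 * i + k + 1) n) +
        ((rankCount (5 * i + (5 - k)) n : ℤ) - rankCount (5 * i + (5 - k) + 1) n)) := by
  have h1 : ∀ i, (rankCount (5 * i + (5 - k)) n) = negRankCount (5 * i + (5 - k)) n :=
    fun i => (negRankCount_eq_rankCount (by omega) n).symm
  have h2 : ∀ i, (rankCount (5 * i + (5 - k) + 1) n) = negRankCount (5 * i + (5 - k) + 1) n :=
    fun i => (negRankCount_eq_rankCount (by omega) n).symm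
  simp_rw [h1, h2]
  simp only [rankModCount, rankCount, negRankCount, Finset.natCast_card_filter,
    ← Finset.sum_sub_distrib, ← Finset.sum_add_distrib]
  rw [Finset.sum_comm]
  exact Finset.sum_congr rfl fun p _ => indicator_sum_eq hk hk4 (abs_partitionRank_le p)

lemma sum_rankModCount (n : ℕ) :
    ∑ k ∈ Finset.range 5, rankModCount k n = Fintype.card (Nat.Partition n) := by
  rw [← Finset.card_univ, Finset.card_eq_sum_card_fiberwise (t := Finset.range 5)
    (f := fun p : Nat.Partition n => (partitionRank p % 5).toNat)]
  · refine Finset.sum_congr rfl fun k _ => ?_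
    rw [rankModCount]
    congr 1
    ext p
    simp only [Finset.mem_filter, Finset.mem_univ, true_and]
    omega
  · intro p _
    simp only [Finset.coe_range, Set.mem_Iio]
    omega

/-- The generating function of the partition numbers. -/
noncomputable def partitionSeries (q : ℂ) : ℂ :=
  ∑' n : ℕ, (Fintype.card (Nat.Partition n) : ℂ) * q ^ n

/-- The generating function of the number of partitions of rank at least `m`. -/
noncomputable def rankSeries (m : ℕ) (q : ℂ) : ℂ := ∑' n : ℕ, (rankCount m n : ℂ) * q ^ n

/-- The general term of Dyson's series, indexed from `0`. -/
noncomputable def dysonTerm (q : ℂ) (m j : ℕ) : ℂ :=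
  (-1) ^ j * q ^ (3 * tri (j + 1) + ((m : ℤ) - 2) * (j + 1))

/-- Dyson's series for the partitions of rank at least `m`. -/
noncomputable def dysonSeries (q : ℂ) (m : ℕ) : ℂ := ∑' j : ℕ, dysonTerm q m j

lemma norm_natCast_mul_pow_le {q : ℂ} {a : ℕ → ℕ} (ha : ∀ n, a n ≤ 2 ^ n) (n : ℕ) :
    ‖(a n : ℂ) * q ^ n‖ ≤ (2 * ‖q‖) ^ n := by
  rw [norm_mul, norm_pow, Complex.norm_natCast, mul_pow]
  gcongr
  exact_mod_cast ha n

lemma summable_natCast_mul_pow {q : ℂ} (hq : ‖q‖ < 1 / 2) {a : ℕ → ℕ} (ha : ∀ n, a n ≤ 2 ^ n) :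
    Summable fun n => (a n : ℂ) * q ^ n :=
  Summable.of_norm_bounded (summable_geometric_of_lt_one (by positivity) (by linarith))
    (norm_natCast_mul_pow_le ha)

lemma summable_partitionSeries {q : ℂ} (hq : ‖q‖ < 1 / 2) :
    Summable fun n : ℕ => (Fintype.card (Nat.Partition n) : ℂ) * q ^ n :=
  summable_natCast_mul_pow hq card_partition_le_two_pow

lemma summable_rankSeries {q : ℂ} (hq : ‖q‖ < 1 / 2) (m : ℕ) :
    Summable fun n : ℕ => (rankCount m n : ℂ) * q ^ n :=
  summable_natCast_mul_pow hq (rankCount_le_two_pow m)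

lemma norm_rankSeries_le {q : ℂ} (hq : ‖q‖ < 1 / 2) (m : ℕ) :
    ‖rankSeries m q‖ ≤ (1 - 2 * ‖q‖)⁻¹ :=
  tsum_of_norm_bounded (hasSum_geometric_of_lt_one (by positivity) (by linarith))
    (norm_natCast_mul_pow_le (rankCount_le_two_pow m))

lemma rankSeries_eq_sum_add {q : ℂ} (hq : ‖q‖ < 1 / 2) (m : ℕ) :
    rankSeries m q = ∑ n ∈ Finset.range (m + 1), (rankCount m n : ℂ) * q ^ n +
      q ^ (m + 1) * (partitionSeries q - rankSeries (m + 3) q) := by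
  rw [rankSeries, ← (summable_rankSeries hq m).sum_add_tsum_nat_add (m + 1), partitionSeries,
    rankSeries, ← (summable_partitionSeries hq).tsum_sub (summable_rankSeries hq _),
    ← tsum_mul_left]
  congr 1
  refine tsum_congr fun k => ?_
  rw [← rankCount_add_rankCount m k, ← add_assoc]
  push_cast
  ring

lemma rankSeries_eq {q : ℂ} (hq : ‖q‖ < 1 / 2) {m : ℕ} (hm : 1 ≤ m) :
    rankSeries m q = q ^ (m + 1) * (partitionSeries q - rankSeries (m + 3) q) := by
  rw [rankSeries_eq_sum_add hq, Finset.sum_eq_zero, zero_add]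
  intro n hn
  rw [rankCount_eq_zero hm (by rw [Finset.mem_range] at hn; omega), Nat.cast_zero, zero_mul]

lemma rankSeries_zero {q : ℂ} (hq : ‖q‖ < 1 / 2) :
    rankSeries 0 q = 1 + q * (partitionSeries q - rankSeries 3 q) := by
  have h : rankCount 0 0 = 1 := by
    have h1 := card_partition_eq 0
    rw [rankCount_eq_zero le_rfl zero_le_one] at h1
    simpa using h1.symm
  rw [rankSeries_eq_sum_add hq]
  simp [h]

lemma partitionSeries_eq {q : ℂ} (hq : ‖q‖ < 1 / 2) :
    partitionSeries q = rankSeries 0 q + rankSeries 1 q := by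
  rw [rankSeries, rankSeries, ← (summable_rankSeries hq _).tsum_add (summable_rankSeries hq _)]
  refine tsum_congr fun n => ?_
  rw [card_partition_eq]
  push_cast
  ring

lemma norm_dysonTerm_le {q : ℂ} (hq0 : q ≠ 0) (hq : ‖q‖ < 1) (m j : ℕ) :
    ‖dysonTerm q m j‖ ≤ ‖q‖ ^ j := by
  rw [dysonTerm, norm_mul, norm_pow, norm_neg, norm_one, one_pow, one_mul, norm_zpow,
    ← zpow_natCast]
  refine zpow_le_zpow_right_of_le_one₀ (norm_pos_iff.2 hq0) hq.le ?_
  have h := self_le_tri (j + 1)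
  have h2 : 0 ≤ (m : ℤ) * (j + 1) := by positivity
  linarith

lemma summable_dysonTerm {q : ℂ} (hq0 : q ≠ 0) (hq : ‖q‖ < 1) (m : ℕ) :
    Summable (dysonTerm q m) :=
  Summable.of_norm_bounded (summable_geometric_of_lt_one (norm_nonneg q) hq)
    (norm_dysonTerm_le hq0 hq m)

lemma norm_dysonSeries_le {q : ℂ} (hq0 : q ≠ 0) (hq : ‖q‖ < 1) (m : ℕ) :
    ‖dysonSeries q m‖ ≤ (1 - ‖q‖)⁻¹ :=
  tsum_of_norm_bounded (hasSum_geometric_of_lt_one (norm_nonneg q) hq)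
    (norm_dysonTerm_le hq0 hq m)

lemma dysonSeries_eq {q : ℂ} (hq0 : q ≠ 0) (hq : ‖q‖ < 1) (m : ℕ) :
    dysonSeries q m = q ^ (m + 1) * (1 - dysonSeries q (m + 3)) := by
  rw [dysonSeries, (summable_dysonTerm hq0 hq m).tsum_eq_zero_add, mul_sub, mul_one, sub_eq_add_neg,
    dysonSeries, ← tsum_mul_left, ← tsum_neg]
  congr 1
  · rw [dysonTerm, pow_zero, one_mul, ← zpow_natCast]
    congr 1
    rw [Nat.cast_zero, zero_add, show tri 1 = 1 from rfl]
    push_cast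
    ring
  · refine tsum_congr fun j => ?_
    rw [dysonTerm, dysonTerm, pow_succ, mul_left_comm, ← zpow_natCast q, ← zpow_add₀ hq0]
    push_cast
    rw [tri_succ ((j : ℤ) + 1),
      show 3 * (tri ((j : ℤ) + 1) + (j + 1) + 1) + ((m : ℤ) - 2) * (j + 1 + 1) =
        m + 1 + (3 * tri (j + 1) + (m + 3 - 2) * (j + 1)) by ring]
    ring

lemma rankSeries_eq_mul_dysonSeries {q : ℂ} (hq0 : q ≠ 0) (hq : ‖q‖ < 1 / 2) {m : ℕ}
    (hm : 1 ≤ m) : rankSeries m q = partitionSeries q * dysonSeries q m := by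
  have hq1 : ‖q‖ < 1 := by linarith
  set B := (1 - 2 * ‖q‖)⁻¹ + ‖partitionSeries q‖ * (1 - ‖q‖)⁻¹
  have hB : ∀ m, ‖rankSeries m q - partitionSeries q * dysonSeries q m‖ ≤ B := fun m => by
    refine (norm_sub_le _ _).trans <| add_le_add (norm_rankSeries_le hq m) ?_
    rw [norm_mul]
    exact mul_le_mul_of_nonneg_left (norm_dysonSeries_le hq0 hq1 m) (norm_nonneg _)
  have key : ∀ k : ℕ, ∀ m, 1 ≤ m →
      ‖rankSeries m q - partitionSeries q * dysonSeries q m‖ ≤ ‖q‖ ^ k * B := by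
    intro k
    induction k with
    | zero => intro m _; simpa using hB m
    | succ k ih =>
      intro m hm
      rw [rankSeries_eq hq hm, dysonSeries_eq hq0 hq1,
        show q ^ (m + 1) * (partitionSeries q - rankSeries (m + 3) q) -
            partitionSeries q * (q ^ (m + 1) * (1 - dysonSeries q (m + 3))) =
          -(q ^ (m + 1) * (rankSeries (m + 3) q - partitionSeries q * dysonSeries q (m + 3)))
          by ring, norm_neg, norm_mul, pow_succ' ‖q‖ k, mul_assoc]
      refine mul_le_mul ?_ (ih _ (by omega)) (norm_nonneg _) (norm_nonneg _)
      rw [norm_pow]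
      exact pow_le_of_le_one (norm_nonneg _) hq1.le (by omega)
  have hlim : Tendsto (fun k : ℕ => ‖q‖ ^ k * B) atTop (𝓝 0) := by
    simpa using (tendsto_pow_atTop_nhds_zero_of_lt_one (norm_nonneg q) hq1).mul_const B
  have h0 := ge_of_tendsto' hlim fun k => key k m hm
  exact sub_eq_zero.1 (norm_le_zero_iff.1 h0)

lemma tsum_int_eq {f : ℤ → ℂ} (hf : Summable f) :
    ∑' n : ℤ, f n = f 0 + ∑' j : ℕ, (f (j + 1) + f (-(j + 1))) := by
  have h1 : Summable fun n : ℕ => f n := hf.comp_injective Nat.cast_injective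
  have h2 : Summable fun n : ℕ => f (-((n : ℤ) + 1)) :=
    hf.comp_injective (i := fun n : ℕ => -((n : ℤ) + 1)) fun a b h => by
      have : -((a : ℤ) + 1) = -((b : ℤ) + 1) := h
      omega
  have h3 : Summable fun n : ℕ => f ((n : ℤ) + 1) := by
    have := (summable_nat_add_iff 1).2 h1
    simpa using this
  rw [tsum_of_nat_of_neg_add_one h1 h2, h1.tsum_eq_zero_add, h3.tsum_add h2, add_assoc]
  simp

lemma neg_one_zpow_natCast_add_one (j : ℕ) : (-1 : ℂ) ^ ((j : ℤ) + 1) = -(-1) ^ j := by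
  rw [zpow_add₀ (by norm_num), zpow_natCast]
  simp

lemma neg_one_zpow_neg (j : ℤ) : (-1 : ℂ) ^ (-j) = (-1) ^ j := by
  rw [zpow_neg, ← inv_zpow, inv_neg, inv_one]

lemma pentSeries_eq {q : ℂ} (hq0 : q ≠ 0) (hq : ‖q‖ < 1) :
    pentSeries q = 1 - dysonSeries q 0 - dysonSeries q 1 := by
  rw [pentSeries, tsum_int_eq (summable_pent_one hq0 hq).of_norm, sub_sub,
    dysonSeries, dysonSeries,
    ← (summable_dysonTerm hq0 hq 0).tsum_add (summable_dysonTerm hq0 hq 1),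
    sub_eq_add_neg (1 : ℂ), ← tsum_neg]
  congr 1
  · simp [tri_zero]
  · refine tsum_congr fun j => ?_
    rw [dysonTerm, dysonTerm, neg_one_zpow_neg, neg_one_zpow_natCast_add_one, tri_neg,
      show 3 * (tri ((j : ℤ) + 1) - (j + 1)) - -((j : ℤ) + 1) =
        3 * tri (j + 1) + (((0 : ℕ) : ℤ) - 2) * (j + 1) by push_cast; ring,
      show 3 * tri ((j : ℤ) + 1) - (j + 1) =
        3 * tri (j + 1) + (((1 : ℕ) : ℤ) - 2) * (j + 1) by push_cast; ring]
    ring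

/-- Euler's pentagonal number theorem, obtained from Dyson's recursion for the rank. -/
theorem partitionSeries_mul_pentSeries {q : ℂ} (hq0 : q ≠ 0) (hq : ‖q‖ < 1 / 2) :
    partitionSeries q * pentSeries q = 1 := by
  have hq1 : ‖q‖ < 1 := by linarith
  have h1 := partitionSeries_eq hq
  have h2 := dysonSeries_eq hq0 hq1 0
  rw [rankSeries_zero hq, rankSeries_eq_mul_dysonSeries hq0 hq (m := 3) (by norm_num),
    rankSeries_eq_mul_dysonSeries hq0 hq le_rfl] at h1
  rw [pentSeries_eq hq0 hq1]
  simp only [zero_add, pow_one] at h2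
  linear_combination h1 - partitionSeries q * h2

lemma summable_prod_pow {ρ σ : ℝ} (hρ : 0 ≤ ρ) (hρ1 : ρ < 1) (hσ : 0 ≤ σ) (hσ1 : σ < 1) :
    Summable fun x : ℕ × ℕ => ρ ^ x.1 * σ ^ x.2 :=
  (summable_geometric_of_lt_one hρ hρ1).mul_of_nonneg (summable_geometric_of_lt_one hσ hσ1)
    (fun _ => pow_nonneg hρ _) (fun _ => pow_nonneg hσ _)

lemma summable_rankCount_prod {q : ℂ} (hq : ‖q‖ < 1 / 2) {l : ℕ} (hl : 1 ≤ l) :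
    Summable fun x : ℕ × ℕ => (rankCount (5 * x.2 + l) x.1 : ℂ) * q ^ x.1 := by
  have ha : 0 ≤ 2 * ‖q‖ := by positivity
  have hs : √(2 * ‖q‖) < 1 := by
    rw [Real.sqrt_lt' one_pos]
    linarith
  refine Summable.of_norm_bounded (summable_prod_pow (Real.sqrt_nonneg _) hs (Real.sqrt_nonneg _) hs)
    fun x => ?_
  rcases le_or_gt x.1 (5 * x.2 + l) with h | h
  · rw [rankCount_eq_zero (by omega) h, Nat.cast_zero, zero_mul, norm_zero]
    positivity
  · refine (norm_natCast_mul_pow_le (rankCount_le_two_pow _) x.1).trans ?_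
    nth_rewrite 1 [← Real.mul_self_sqrt ha]
    rw [mul_pow]
    gcongr ?_ * ?_
    exact pow_le_pow_of_le_one (Real.sqrt_nonneg _) hs.le (by omega)

/-- The generating function of the number of partitions, weighted by the number of `i` such that the
rank is at least `5 * i + l`. -/
lemma hasSum_sum_rankCount {q : ℂ} (hq : ‖q‖ < 1 / 2) {l : ℕ} (hl : 1 ≤ l) :
    HasSum (fun n => (∑ i ∈ Finset.range (n + 1), (rankCount (5 * i + l) n : ℂ)) * q ^ n)
      (∑' i : ℕ, rankSeries (5 * i + l) q) := by
  have h := summable_rankCount_prod hq hl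
  have e : ∀ n, (∑ i ∈ Finset.range (n + 1), (rankCount (5 * i + l) n : ℂ)) * q ^ n =
      ∑' i, (rankCount (5 * i + l) n : ℂ) * q ^ n := fun n => by
    rw [tsum_eq_sum (s := Finset.range (n + 1)), Finset.sum_mul]
    intro i hi
    rw [Finset.mem_range] at hi
    rw [rankCount_eq_zero (by omega) (by omega), Nat.cast_zero, zero_mul]
  simp_rw [e]
  have h2 := h.prod.hasSum
  rwa [← Summable.tsum_comm (f := fun n i => (rankCount (5 * i + l) n : ℂ) * q ^ n) h] at h2

/-- The result of summing Dyson's series over `m ≡ l` modulo `5`. -/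
noncomputable def dysonLambert (q : ℂ) (l : ℕ) : ℂ :=
  ∑' j : ℕ, dysonTerm q l j * (1 - q ^ (5 * (j + 1)))⁻¹

lemma dysonTerm_add {q : ℂ} (hq0 : q ≠ 0) (l i j : ℕ) :
    dysonTerm q (5 * i + l) j = dysonTerm q l j * (q ^ (5 * (j + 1))) ^ i := by
  rw [dysonTerm, dysonTerm, ← pow_mul, ← zpow_natCast q, mul_assoc, ← zpow_add₀ hq0]
  push_cast
  ring_nf

lemma norm_pow_five_mul_lt_one {q : ℂ} (hq : ‖q‖ < 1) (j : ℕ) : ‖q ^ (5 * (j + 1))‖ < 1 := by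
  rw [norm_pow]
  exact pow_lt_one₀ (norm_nonneg _) hq (by omega)

lemma summable_dysonTerm_prod {q : ℂ} (hq0 : q ≠ 0) (hq : ‖q‖ < 1) (l : ℕ) :
    Summable fun x : ℕ × ℕ => dysonTerm q (5 * x.2 + l) x.1 := by
  refine Summable.of_norm_bounded (summable_prod_pow (norm_nonneg q) hq (norm_nonneg q) hq)
    fun x => ?_
  rw [dysonTerm_add hq0, norm_mul, norm_pow]
  refine mul_le_mul (norm_dysonTerm_le hq0 hq _ _) (pow_le_pow_left₀ (norm_nonneg _) ?_ _)
    (by positivity) (by positivity)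
  rw [norm_pow]
  exact pow_le_of_le_one (norm_nonneg _) hq.le (by omega)

lemma tsum_dysonSeries {q : ℂ} (hq0 : q ≠ 0) (hq : ‖q‖ < 1) (l : ℕ) :
    ∑' i : ℕ, dysonSeries q (5 * i + l) = dysonLambert q l := by
  simp only [dysonSeries, dysonLambert]
  rw [Summable.tsum_comm (f := fun j i => dysonTerm q (5 * i + l) j)
    (summable_dysonTerm_prod hq0 hq l)]
  refine tsum_congr fun j => ?_
  simp_rw [dysonTerm_add hq0]
  rw [tsum_mul_left, tsum_geometric_of_norm_lt_one (norm_pow_five_mul_lt_one hq j)]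

lemma summable_dysonLambert {q : ℂ} (hq0 : q ≠ 0) (hq : ‖q‖ < 1) (l : ℕ) :
    Summable fun j : ℕ => dysonTerm q l j * (1 - q ^ (5 * (j + 1)))⁻¹ := by
  have h := (summable_dysonTerm_prod hq0 hq l).prod
  refine h.congr fun j => ?_
  simp_rw [dysonTerm_add hq0]
  rw [tsum_mul_left, tsum_geometric_of_norm_lt_one (norm_pow_five_mul_lt_one hq j)]

lemma hasSum_sum_rankCount_dyson {q : ℂ} (hq0 : q ≠ 0) (hq : ‖q‖ < 1 / 2) {l : ℕ} (hl : 1 ≤ l) :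
    HasSum (fun n => (∑ i ∈ Finset.range (n + 1), (rankCount (5 * i + l) n : ℂ)) * q ^ n)
      (partitionSeries q * dysonLambert q l) := by
  have h := hasSum_sum_rankCount hq hl
  rwa [tsum_congr fun i => rankSeries_eq_mul_dysonSeries hq0 hq (by omega : 1 ≤ 5 * i + l),
    tsum_mul_left, tsum_dysonSeries hq0 (by linarith)] at h

lemma hasSum_rankModCount {q : ℂ} (hq0 : q ≠ 0) (hq : ‖q‖ < 1 / 2) {k : ℕ} (hk : 1 ≤ k)
    (hk4 : k ≤ 4) :
    HasSum (fun n => (rankModCount k n : ℂ) * q ^ n)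
      (partitionSeries q * (dysonLambert q k - dysonLambert q (k + 1) +
        (dysonLambert q (5 - k) - dysonLambert q (5 - k + 1)))) := by
  have h := ((hasSum_sum_rankCount_dyson hq0 hq hk).sub
    (hasSum_sum_rankCount_dyson hq0 hq (l := k + 1) (by omega))).add
    ((hasSum_sum_rankCount_dyson hq0 hq (l := 5 - k) (by omega)).sub
    (hasSum_sum_rankCount_dyson hq0 hq (l := 5 - k + 1) (by omega)))
  rw [← mul_sub, ← mul_sub, ← mul_add] at h
  refine (congrArg (HasSum · _) (funext fun n => ?_)).mpr h
  have e : (rankModCount k n : ℂ) = ((rankModCount k n : ℤ) : ℂ) := by push_cast; rfl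
  rw [e, rankModCount_eq_sum hk hk4]
  push_cast
  rw [Finset.sum_add_distrib, Finset.sum_sub_distrib, Finset.sum_sub_distrib]
  simp only [← add_assoc]
  ring

lemma lambert_eq {q : ℂ} (hq0 : q ≠ 0) (hq : ‖q‖ < 1) {b : ℤ} {l l' : ℕ} (hl : b + 2 = l)
    (hl' : 4 - b = l') : lambert q b = dysonLambert q l' - dysonLambert q l := by
  rw [lambert, tsum_int_eq (summable_lambert hq0 hq b).of_norm, dysonLambert, dysonLambert,
    ← (summable_dysonLambert hq0 hq l').tsum_sub (summable_dysonLambert hq0 hq l)]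
  simp only [mul_zero, zpow_zero, sub_self, inv_zero, zero_add]
  refine tsum_congr fun j => ?_
  obtain rfl : b = l - 2 := by omega
  have hj : q ^ (5 * (j + 1)) ≠ 1 := fun h => by
    have := norm_pow_five_mul_lt_one hq j
    rw [h, norm_one] at this
    exact lt_irrefl _ this
  have e1 : q ^ (5 * ((j : ℤ) + 1)) = q ^ (5 * (j + 1)) := by
    rw [← zpow_natCast]
    push_cast
    rfl
  have e2 : q ^ (5 * -((j : ℤ) + 1)) = (q ^ (5 * (j + 1)))⁻¹ := by
    rw [mul_neg, zpow_neg, e1]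
  have e3 : q ^ (3 * tri (-((j : ℤ) + 1)) + ((l : ℤ) - 2) * -((j : ℤ) + 1)) =
      q ^ (3 * tri ((j : ℤ) + 1) + ((l' : ℤ) - 2) * ((j : ℤ) + 1)) / q ^ (5 * (j + 1)) := by
    rw [← e1, ← zpow_sub₀ hq0, tri_neg, ← hl']
    ring_nf
  rw [dysonTerm, dysonTerm, neg_one_zpow_neg, neg_one_zpow_natCast_add_one, e1, e2, e3]
  have hq5 : q ^ (5 * (j + 1)) ≠ 0 := pow_ne_zero _ hq0
  generalize q ^ (5 * (j + 1)) = Q at *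
  generalize q ^ (3 * tri ((j : ℤ) + 1) + ((l' : ℤ) - 2) * ((j : ℤ) + 1)) = A
  generalize q ^ (3 * tri ((j : ℤ) + 1) + ((l : ℤ) - 2) * ((j : ℤ) + 1)) = B
  have h1 : 1 - Q ≠ 0 := sub_ne_zero.2 hj.symm
  have h2 : 1 - Q⁻¹ = -((1 - Q) / Q) := by field_simp; ring
  rw [h2]
  field_simp
  ring

/-- If `k ∈ {1, …, 4}`, then `∑ (5 N(k, 5, n) - p(n)) q ^ n` has no terms with `n ≡ 4` modulo `5`. -/
lemma exists_hasSum_rankModCount {k : ℕ} (hk : 1 ≤ k) (hk4 : k ≤ 4) :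
    ∃ Z : ℕ → ℂ → ℂ, ∀ q : ℂ, q ≠ 0 → ‖q‖ < 1 / 16 →
      HasSum (fun n => (5 * (rankModCount k n : ℂ) - Fintype.card (Nat.Partition n)) * q ^ n)
        (∑ c ∈ Finset.range 4, q ^ c * Z c (q ^ 5)) := by
  obtain ⟨X, Y, hXY⟩ := exists_lambert_dissection
  have main : ∀ q : ℂ, q ≠ 0 → ‖q‖ < 1 / 16 →
      HasSum (fun n => (5 * (rankModCount k n : ℂ) - Fintype.card (Nat.Partition n)) * q ^ n)
        (5 * (partitionSeries q * (dysonLambert q k - dysonLambert q (k + 1) +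
          (dysonLambert q (5 - k) - dysonLambert q (5 - k + 1)))) - partitionSeries q) := by
    intro q hq0 hq
    have h := ((hasSum_rankModCount hq0 (by linarith) hk hk4).mul_left 5).sub
      (summable_partitionSeries (by linarith : ‖q‖ < 1 / 2)).hasSum
    refine (congrArg (HasSum · _) (funext fun n => ?_)).mpr h
    ring
  have hk' : k = 1 ∨ k = 4 ∨ k = 2 ∨ k = 3 := by omega
  have h14 : k = 1 ∨ k = 4 → ∃ Z : ℕ → ℂ → ℂ, ∀ q : ℂ, q ≠ 0 → ‖q‖ < 1 / 16 →
      HasSum (fun n => (5 * (rankModCount k n : ℂ) - Fintype.card (Nat.Partition n)) * q ^ n)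
        (∑ c ∈ Finset.range 4, q ^ c * Z c (q ^ 5)) := by
    intro h
    refine ⟨fun c q => X c q - Y c q, fun q hq0 hq => ?_⟩
    convert main q hq0 hq using 1
    have hq1 : ‖q‖ < 1 := by linarith
    have hP := partitionSeries_mul_pentSeries hq0 (by linarith : ‖q‖ < 1 / 2)
    obtain ⟨hX, hY⟩ := hXY q hq0 hq
    rw [lambert_eq hq0 hq1 (b := 0) (l := 2) (l' := 4) (by norm_num) (by norm_num)] at hX
    rw [lambert_eq hq0 hq1 (b := 3) (l := 5) (l' := 1) (by norm_num) (by norm_num)] at hY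
    simp only [mul_sub, Finset.sum_sub_distrib]
    rcases h with rfl | rfl <;>
      linear_combination -(partitionSeries q) * (hX - hY) -
        (∑ c ∈ Finset.range 4, q ^ c * X c (q ^ 5) - ∑ c ∈ Finset.range 4, q ^ c * Y c (q ^ 5)) * hP
  have h23 : k = 2 ∨ k = 3 → ∃ Z : ℕ → ℂ → ℂ, ∀ q : ℂ, q ≠ 0 → ‖q‖ < 1 / 16 →
      HasSum (fun n => (5 * (rankModCount k n : ℂ) - Fintype.card (Nat.Partition n)) * q ^ n)
        (∑ c ∈ Finset.range 4, q ^ c * Z c (q ^ 5)) := by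
    intro h
    refine ⟨fun c q => -X c q, fun q hq0 hq => ?_⟩
    convert main q hq0 hq using 1
    have hq1 : ‖q‖ < 1 := by linarith
    have hP := partitionSeries_mul_pentSeries hq0 (by linarith : ‖q‖ < 1 / 2)
    obtain ⟨hX, -⟩ := hXY q hq0 hq
    rw [lambert_eq hq0 hq1 (b := 0) (l := 2) (l' := 4) (by norm_num) (by norm_num)] at hX
    simp only [mul_neg, Finset.sum_neg_distrib]
    rcases h with rfl | rfl <;>
      linear_combination (partitionSeries q) * hX +
        (∑ c ∈ Finset.range 4, q ^ c * X c (q ^ 5)) * hP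
  rcases hk' with h | h | h | h
  exacts [h14 (Or.inl h), h14 (Or.inr h), h23 (Or.inl h), h23 (Or.inr h)]

lemma coeff_eq_zero_of_hasSum_zero {b : ℕ → ℂ} {r : ℝ} (hr : 0 < r)
    (h : ∀ q : ℂ, q ≠ 0 → ‖q‖ < r → HasSum (fun n => b n * q ^ n) 0) (h0 : b 0 = 0) (n : ℕ) :
    b n = 0 := by
  have hb : HasFPowerSeriesAt (0 : ℂ → ℂ) (FormalMultilinearSeries.ofScalars ℂ b) 0 := by
    rw [hasFPowerSeriesAt_iff]
    filter_upwards [Metric.ball_mem_nhds (0 : ℂ) hr] with q hq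
    rw [mem_ball_zero_iff] at hq
    simp only [FormalMultilinearSeries.coeff_ofScalars, smul_eq_mul, Pi.zero_apply]
    rcases eq_or_ne q 0 with rfl | hq0
    · have e : ∀ n, (0 : ℂ) ^ n * b n = 0 := fun n => by
        rcases Nat.eq_zero_or_pos n with rfl | hn
        · rw [h0, mul_zero]
        · rw [zero_pow hn.ne', zero_mul]
      simp only [e]
      exact hasSum_zero
    · simpa only [mul_comm] using h q hq0 hq
  rw [← FormalMultilinearSeries.coeff_ofScalars (𝕜 := ℂ) (p := b) (n := n), hb.eq_zero]
  rfl

lemma IsPrimitiveRoot.sum_pow_mul_eq {w : ℂ} (hw : IsPrimitiveRoot w 5) (m : ℕ) :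
    ∑ j ∈ Finset.range 5, w ^ (j * m) = if 5 ∣ m then 5 else 0 := by
  simp_rw [mul_comm _ m, pow_mul]
  split_ifs with h
  · obtain ⟨k, rfl⟩ := h
    simp [pow_mul, hw.pow_eq_one]
  · have hc : m.Coprime 5 := ((Nat.Prime.coprime_iff_not_dvd Nat.prime_five).2 h).symm
    exact (hw.pow_of_coprime m hc).geom_sum_eq_zero (by norm_num)

lemma coeff_eq_zero_of_dissection {a : ℕ → ℂ} {r : ℝ} (hr : 0 < r) {Z : ℕ → ℂ → ℂ}
    (h : ∀ q : ℂ, q ≠ 0 → ‖q‖ < r →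
      HasSum (fun n => a n * q ^ n) (∑ c ∈ Finset.range 4, q ^ c * Z c (q ^ 5))) (n : ℕ) :
    a (5 * n + 4) = 0 := by
  have hw := Complex.isPrimitiveRoot_exp 5 (by norm_num)
  generalize Complex.exp (2 * Real.pi * Complex.I / (5 : ℕ)) = w at hw
  have hw0 : w ≠ 0 := hw.ne_zero (by norm_num)
  have hwn : ‖w‖ = 1 := hw.norm'_eq_one (by norm_num)
  have hb : ∀ m, (if 5 ∣ m + 1 then 5 else 0) * a m = 0 := by
    refine coeff_eq_zero_of_hasSum_zero hr (fun q hq0 hq => ?_) (by simp)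
    have h1 := hasSum_sum (s := Finset.range 5) fun j _ =>
      (h (w ^ j * q) (mul_ne_zero (pow_ne_zero j hw0) hq0)
        (by rwa [norm_mul, norm_pow, hwn, one_pow, one_mul])).mul_left (w ^ j)
    have e1 : ∀ m, (if 5 ∣ m + 1 then 5 else 0) * a m * q ^ m =
        ∑ j ∈ Finset.range 5, w ^ j * (a m * (w ^ j * q) ^ m) := fun m => by
      rw [← hw.sum_pow_mul_eq, Finset.sum_mul, Finset.sum_mul]
      refine Finset.sum_congr rfl fun j _ => ?_
      rw [mul_pow, ← pow_mul, mul_add, pow_add]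
      ring
    have e2 : ∑ j ∈ Finset.range 5,
        w ^ j * ∑ c ∈ Finset.range 4, (w ^ j * q) ^ c * Z c ((w ^ j * q) ^ 5) = 0 := by
      have e3 : ∀ j, (w ^ j * q) ^ 5 = q ^ 5 := fun j => by
        rw [mul_pow, ← pow_mul, mul_comm j, pow_mul, hw.pow_eq_one, one_pow, one_mul]
      simp_rw [e3, Finset.mul_sum]
      rw [Finset.sum_comm]
      refine Finset.sum_eq_zero fun c hc => ?_
      rw [Finset.mem_range] at hc
      have e4 : ∀ j, w ^ j * ((w ^ j * q) ^ c * Z c (q ^ 5)) =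
          w ^ (j * (c + 1)) * (q ^ c * Z c (q ^ 5)) := fun j => by
        rw [mul_pow, ← pow_mul, mul_add, pow_add]
        ring
      simp_rw [e4]
      rw [← Finset.sum_mul, hw.sum_pow_mul_eq, if_neg (by omega), zero_mul]
    rw [e2] at h1
    simp_rw [e1]
    exact h1
  have := hb (5 * n + 4)
  rw [if_pos (by omega)] at this
  simpa using this

lemma five_mul_rankModCount {k : ℕ} (hk : 1 ≤ k) (hk4 : k ≤ 4) (n : ℕ) :
    5 * rankModCount k (5 * n + 4) = Fintype.card (Nat.Partition (5 * n + 4)) := by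
  obtain ⟨Z, hZ⟩ := exists_hasSum_rankModCount hk hk4
  have := sub_eq_zero.1 (coeff_eq_zero_of_dissection (by norm_num) hZ n)
  exact_mod_cast this

/-- **Dyson's conjecture mod 5** (Atkin–Swinnerton-Dyer): for every `n ≥ 0` and every
`0 ≤ k ≤ 4`, the number of partitions of `5n + 4` with rank congruent to `k` modulo `5`
equals `p(5n+4) / 5`. -/
theorem rank_equidistribution_mod_five (n : ℕ) (k : ℤ) (hk0 : 0 ≤ k) (hk4 : k ≤ 4) :
    ((Finset.univ.filter
        (fun p : Nat.Partition (5 * n + 4) => partitionRank p % 5 = k)).card : ℚ) =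
      (Fintype.card (Nat.Partition (5 * n + 4)) : ℚ) / 5 := by
  lift k to ℕ using hk0
  have h : 5 * rankModCount k (5 * n + 4) = Fintype.card (Nat.Partition (5 * n + 4)) := by
    rcases Nat.eq_zero_or_pos k with rfl | hk
    · have h0 := sum_rankModCount (5 * n + 4)
      have h1 := five_mul_rankModCount (k := 1) le_rfl (by norm_num) n
      have h2 := five_mul_rankModCount (k := 2) (by norm_num) (by norm_num) n
      have h3 := five_mul_rankModCount (k := 3) (by norm_num) (by norm_num) n
      have h4 := five_mul_rankModCount (k := 4) (by norm_num) le_rfl n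
      simp only [Finset.sum_range_succ, Finset.sum_range_zero] at h0
      omega
    · exact five_mul_rankModCount hk (by omega) n
  rw [eq_div_iff (by norm_num), mul_comm, ← h, rankModCount]
  push_cast
  rfl
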